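/- If α ≥ α_th, then lim_{A→∞} [ C_H(A, αA) − nr·log A ] = (1/2)·log( V_H² / (2πe)^{nr} ). -/

import Mathlib

open MeasureTheory ProbabilityTheory Matrix Filter Topology
open scoped ENNReal NNReal BigOperators

noncomputable section

namespace MimoOptical

variable {nt nr : ℕ}

/-- The law of a standard Gaussian vector `Z ~ N(0, I_n)` on `ℝ^n`. -/
def stdGaussian (n : ℕ) : Measure (Fin n → ℝ) :=
  Measure.pi fun _ => gaussianReal 0 1

/-- Real-valued Kullback–Leibler divergence `∫ log (dμ/dν) dμ`
(with junk value if not absolutely continuous or not integrable). -/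
def klDivR {Ω : Type*} [MeasurableSpace Ω] (μ ν : Measure Ω) : ℝ :=
  ∫ ω, Real.log (μ.rnDeriv ν ω).toReal ∂μ

/-- Mutual information of a joint law on a product space: the KL divergence between
the joint law and the product of its marginals. -/
def mutualInfoJoint {β γ : Type*} [MeasurableSpace β] [MeasurableSpace γ]
    (π : Measure (β × γ)) : ℝ :=
  klDivR π ((π.map Prod.fst).prod (π.map Prod.snd))

/-- Joint law of `(X, H X + Z)` where `X ~ μ` and `Z ~ N(0, I_nr)` is independent of `X`. -/
def jointLaw (H : Matrix (Fin nr) (Fin nt) ℝ) (μ : Measure (Fin nt → ℝ)) :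
    Measure ((Fin nt → ℝ) × (Fin nr → ℝ)) :=
  (μ.prod (stdGaussian nr)).map (fun p => (p.1, H.mulVec p.1 + p.2))

/-- An admissible input distribution: a probability measure on `[0, A]^nt`
with average power `E[‖X‖₁] ≤ avg`. -/
def Admissible (nt : ℕ) (A avg : ℝ) (μ : Measure (Fin nt → ℝ)) : Prop :=
  IsProbabilityMeasure μ ∧ (∀ᵐ x ∂μ, ∀ k, x k ∈ Set.Icc (0 : ℝ) A) ∧
    (∫ x, ∑ k, |x k| ∂μ) ≤ avg

/-- Capacity of the MIMO optical intensity channel with peak power `A` and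
average power `avg`. -/
def capacity (H : Matrix (Fin nr) (Fin nt) ℝ) (A avg : ℝ) : ℝ :=
  sSup { c | ∃ μ : Measure (Fin nt → ℝ),
    Admissible nt A avg μ ∧ c = mutualInfoJoint (jointLaw H μ) }

/-- The zonotope `R(M) = { M λ : λ ∈ [0,A]^k }`. -/
def zonotope {n k : ℕ} (M : Matrix (Fin n) (Fin k) ℝ) (A : ℝ) : Set (Fin n → ℝ) :=
  { x | ∃ lam : Fin k → ℝ, (∀ i, lam i ∈ Set.Icc 0 A) ∧ x = M.mulVec lam }

/-- The collection `𝒰` of `nr`-element subsets of columns that are linearly independent. -/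
def goodSets (H : Matrix (Fin nr) (Fin nt) ℝ) : Set (Finset (Fin nt)) :=
  { U | U.card = nr ∧ LinearIndependent ℝ (fun j : {x // x ∈ U} => fun i => H i j.1) }

/-- The square matrix `H_U` whose columns are the columns of `H` indexed by `U`
(junk value, the identity, if `U.card ≠ nr`). -/
def HU (H : Matrix (Fin nr) (Fin nt) ℝ) (U : Finset (Fin nt)) :
    Matrix (Fin nr) (Fin nr) ℝ :=
  if h : U.card = nr then H.submatrix id (fun i => U.orderEmbOfFin h i) else 1

/-- `a_{U,j} = 1ᵀ H_U⁻¹ h_j`. -/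
def aUj (H : Matrix (Fin nr) (Fin nt) ℝ) (U : Finset (Fin nt)) (j : Fin nt) : ℝ :=
  ∑ i, ((HU H U)⁻¹).mulVec (fun r => H r j) i

/-- `g_{U,j} = 1` if `a_{U,j} > 1` and `0` otherwise. -/
def gUj (H : Matrix (Fin nr) (Fin nt) ℝ) (U : Finset (Fin nt)) (j : Fin nt) : ℝ :=
  if 1 < aUj H U j then 1 else 0

/-- `s_U = Σ_{j ∈ Uᶜ} g_{U,j}`. -/
def sU (H : Matrix (Fin nr) (Fin nt) ℝ) (U : Finset (Fin nt)) : ℝ :=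
  ∑ j ∈ Uᶜ, gUj H U j

/-- `v_U = A Σ_{j ∈ Uᶜ} g_{U,j} h_j`. -/
def vU (H : Matrix (Fin nr) (Fin nt) ℝ) (A : ℝ) (U : Finset (Fin nt)) : Fin nr → ℝ :=
  fun r => A * ∑ j ∈ Uᶜ, gUj H U j * H r j

/-- The parallelepiped `D_U = R(H_U)`. -/
def DU (H : Matrix (Fin nr) (Fin nt) ℝ) (A : ℝ) (U : Finset (Fin nt)) :
    Set (Fin nr → ℝ) :=
  zonotope (HU H U) A

/-- The shifted parallelepiped `v_U + D_U`. -/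
def cell (H : Matrix (Fin nr) (Fin nt) ℝ) (A : ℝ) (U : Finset (Fin nt)) :
    Set (Fin nr → ℝ) :=
  (fun d => vU H A U + d) '' DU H A U

/-- `V_H = Σ_{U ∈ 𝒰} |det H_U|`. -/
def VH (H : Matrix (Fin nr) (Fin nt) ℝ) : ℝ :=
  ∑ᶠ U ∈ goodSets H, |(HU H U).det|

/-- `q_U = |det H_U| / V_H`. -/
def qU (H : Matrix (Fin nr) (Fin nt) ℝ) (U : Finset (Fin nt)) : ℝ :=
  |(HU H U).det| / VH H

/-- `α_th = nr/2 + Σ_{U ∈ 𝒰} s_U q_U`. -/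
def alphaTh (H : Matrix (Fin nr) (Fin nt) ℝ) : ℝ :=
  (nr : ℝ) / 2 + ∑ᶠ U ∈ goodSets H, sU H U * qU H U

/-- A probability vector on `𝒰`. -/
def ProbVec (H : Matrix (Fin nr) (Fin nt) ℝ) (p : Finset (Fin nt) → ℝ) : Prop :=
  (∀ U, 0 ≤ p U) ∧ (∀ U, U ∉ goodSets H → p U = 0) ∧ (∑ᶠ U ∈ goodSets H, p U) = 1

/-- Kullback–Leibler divergence `D(p‖q)` between probability vectors on `𝒰`. -/
def Dkl (H : Matrix (Fin nr) (Fin nt) ℝ) (p q : Finset (Fin nt) → ℝ) : ℝ :=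
  ∑ᶠ U ∈ goodSets H, p U * Real.log (p U / q U)

/-- `σ_{U,ℓ}`: square root of the `ℓ`-th diagonal entry of `H_U⁻¹ (H_U⁻¹)ᵀ`. -/
def sigmaUl (H : Matrix (Fin nr) (Fin nt) ℝ) (U : Finset (Fin nt)) (ℓ : Fin nr) : ℝ :=
  Real.sqrt ((((HU H U)⁻¹) * ((HU H U)⁻¹)ᵀ) ℓ ℓ)

/-- The trace of the covariance matrix of `X̄ = H X` when `X ~ μ`. -/
def traceCov (H : Matrix (Fin nr) (Fin nt) ℝ) (μ : Measure (Fin nt → ℝ)) : ℝ :=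
  ∑ i, ((∫ x, (H.mulVec x i) ^ 2 ∂μ) - (∫ x, H.mulVec x i ∂μ) ^ 2)

/-- The Gaussian Q-function. -/
def Qf (x : ℝ) : ℝ :=
  ∫ t in Set.Ioi x, Real.exp (-t ^ 2 / 2) / Real.sqrt (2 * Real.pi)

/-- The high-SNR penalty `ν` due to the average-power constraint. -/
def nuVal (H : Matrix (Fin nr) (Fin nt) ℝ) (α : ℝ) : ℝ :=
  sSup { y | ∃ lam mu : ℝ,
    lam ∈ Set.Ioo (max 0 ((nr : ℝ) / 2 + α - alphaTh H)) (min ((nr : ℝ) / 2) α) ∧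
    0 < mu ∧
    1 / mu - Real.exp (-mu) / (1 - Real.exp (-mu)) = lam / (nr : ℝ) ∧
    y = (nr : ℝ) * (1 - Real.log (mu / (1 - Real.exp (-mu)))
          - mu * Real.exp (-mu) / (1 - Real.exp (-mu)))
        - sInf { d | ∃ p : Finset (Fin nt) → ℝ, ProbVec H p ∧
            (∑ᶠ U ∈ goodSets H, p U * sU H U) = α - lam ∧ d = Dkl H p (qU H) } }

end MimoOptical

namespace MimoOptical
variable {nt nr : ℕ}

/-- The density of the standard Gaussian vector. -/
def phi (n : ℕ) (z : Fin n → ℝ) : ℝ := ∏ i, gaussianPDFReal 0 1 (z i)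

lemma phi_pos (n : ℕ) (z : Fin n → ℝ) : 0 < phi n z :=
  Finset.prod_pos fun _ _ => gaussianPDFReal_pos 0 1 _ one_ne_zero

lemma measurable_phi (n : ℕ) : Measurable (phi n) := by
  unfold phi
  exact Finset.measurable_prod _ fun i _ => (measurable_gaussianPDFReal 0 1).comp (measurable_pi_apply i)

lemma log_phi (n : ℕ) (z : Fin n → ℝ) :
    Real.log (phi n z) = -(n / 2) * Real.log (2 * Real.pi) - (∑ i, z i ^ 2) / 2 := by
  unfold phi
  rw [Real.log_prod (fun i _ => (gaussianPDFReal_pos 0 1 _ one_ne_zero).ne')]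
  have : ∀ x : ℝ, Real.log (gaussianPDFReal 0 1 x) = -(1/2) * Real.log (2 * Real.pi) - x ^ 2 / 2 := by
    intro x
    unfold gaussianPDFReal
    rw [Real.log_mul (by positivity) (by positivity), Real.log_exp, Real.log_inv, Real.log_sqrt (by positivity)]
    simp
    ring
  simp only [this, Finset.sum_sub_distrib, Finset.sum_const, Finset.card_univ, Fintype.card_fin, Finset.sum_div]
  simp
  ring

lemma phi_eq (n : ℕ) (z : Fin n → ℝ) :
    phi n z = Real.exp (-(n / 2) * Real.log (2 * Real.pi) - (∑ i, z i ^ 2) / 2) := by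
  rw [← log_phi, Real.exp_log (phi_pos n z)]

lemma stdGaussian_eq (n : ℕ) :
    stdGaussian n = (volume : Measure (Fin n → ℝ)).withDensity (fun z => ENNReal.ofReal (phi n z)) := by
  unfold stdGaussian
  refine (Measure.pi_eq ?_)
  intro s hs
  rw [withDensity_apply _ (MeasurableSet.univ_pi hs)]
  have h1 : ∀ i, gaussianReal 0 1 (s i) = ENNReal.ofReal (∫ x in s i, gaussianPDFReal 0 1 x) := by
    intro i
    exact gaussianReal_apply_eq_integral 0 one_ne_zero (s i)
  have h2 : ∀ i, Integrable (gaussianPDFReal 0 1) (volume.restrict (s i)) := fun i =>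
    (integrable_gaussianPDFReal 0 1).restrict
  simp only [h1]
  rw [← ENNReal.ofReal_prod_of_nonneg (fun i _ => integral_nonneg fun x => gaussianPDFReal_nonneg 0 1 x),
    volume_pi, Measure.restrict_pi_pi,
    ← integral_fintype_prod_eq_prod (fun _ => gaussianPDFReal 0 1), ofReal_integral_eq_lintegral_ofReal]
  · rfl
  · exact Integrable.fintype_prod (f := fun _ => gaussianPDFReal 0 1) h2
  · exact Eventually.of_forall fun z => (phi_pos n z).le

instance (n : ℕ) : IsProbabilityMeasure (stdGaussian n) := by
  unfold stdGaussian; infer_instance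

lemma integral_sq_gaussian (n : ℕ) (i : Fin n) :
    Integrable (fun z : Fin n → ℝ => z i ^ 2) (stdGaussian n) ∧ ∫ z, z i ^ 2 ∂stdGaussian n = 1 := by
  have hmp : MeasurePreserving (Function.eval i) (stdGaussian n) (gaussianReal 0 1) :=
    measurePreserving_eval (fun _ : Fin n => gaussianReal 0 1) i
  have hsqint : Integrable (fun x : ℝ => x ^ 2) (gaussianReal 0 1) :=
    (memLp_id_gaussianReal (μ := 0) (v := 1) 2).integrable_sq
  have hval : ∫ x, x ^ 2 ∂gaussianReal 0 1 = 1 := by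
    have h := variance_id_gaussianReal (μ := 0) (v := 1)
    rw [variance_of_integral_eq_zero aemeasurable_id (by simp)] at h
    simpa using h
  constructor
  · exact hmp.integrable_comp_of_integrable hsqint
  · rw [← hval, ← hmp.map_eq, integral_map hmp.measurable.aemeasurable (by fun_prop)]

lemma integral_sumsq_gaussian (n : ℕ) :
    Integrable (fun z : Fin n → ℝ => ∑ i, z i ^ 2) (stdGaussian n) ∧
      ∫ z, ∑ i, z i ^ 2 ∂stdGaussian n = n := by
  constructor
  · exact integrable_finsetSum _ fun i _ => (integral_sq_gaussian n i).1
  · rw [integral_finsetSum _ fun i _ => (integral_sq_gaussian n i).1]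
    simp [(integral_sq_gaussian n _).2]

/-- The output density. -/
def fY (H : Matrix (Fin nr) (Fin nt) ℝ) (μ : Measure (Fin nt → ℝ)) (y : Fin nr → ℝ) : ℝ≥0∞ :=
  ∫⁻ x, ENNReal.ofReal (phi nr (y - H.mulVec x)) ∂μ

lemma measurable_mulVec (H : Matrix (Fin nr) (Fin nt) ℝ) : Measurable (fun x => H.mulVec x) := by
  have : Continuous (fun x : Fin nt → ℝ => H.mulVec x) := by fun_prop
  exact this.measurable

lemma measurable_ker (H : Matrix (Fin nr) (Fin nt) ℝ) :
    Measurable (fun p : (Fin nt → ℝ) × (Fin nr → ℝ) => ENNReal.ofReal (phi nr (p.2 - H.mulVec p.1))) := by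
  have := measurable_mulVec H
  exact ((measurable_phi nr).comp (by fun_prop)).ennreal_ofReal

lemma measurable_fY (H : Matrix (Fin nr) (Fin nt) ℝ) (μ : Measure (Fin nt → ℝ)) [IsProbabilityMeasure μ] :
    Measurable (fY H μ) := by
  unfold fY
  exact Measurable.lintegral_prod_left' (measurable_ker H)

lemma measurable_shear (H : Matrix (Fin nr) (Fin nt) ℝ) :
    Measurable (fun p : (Fin nt → ℝ) × (Fin nr → ℝ) => (p.1, H.mulVec p.1 + p.2)) := by
  have := measurable_mulVec H
  fun_prop

lemma jointLaw_eq (H : Matrix (Fin nr) (Fin nt) ℝ) (μ : Measure (Fin nt → ℝ)) [IsProbabilityMeasure μ] :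
    jointLaw H μ = (μ.prod volume).withDensity
      (fun p => ENNReal.ofReal (phi nr (p.2 - H.mulVec p.1))) := by
  ext s hs
  rw [withDensity_apply _ hs, jointLaw, Measure.map_apply (measurable_shear H) hs,
    Measure.prod_apply (measurable_shear H hs), ← lintegral_indicator hs,
    lintegral_prod _ ((measurable_ker H).indicator hs).aemeasurable]
  refine lintegral_congr fun x => ?_
  have hm : MeasurableSet {y : Fin nr → ℝ | (x, y) ∈ s} := measurable_prodMk_left hs
  rw [stdGaussian_eq, withDensity_apply _ (measurable_prodMk_left (measurable_shear H hs)),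
    ← lintegral_indicator (measurable_prodMk_left (measurable_shear H hs))]
  refine Eq.trans ?_ (lintegral_add_left_eq_self (fun y => s.indicator (fun p =>
    ENNReal.ofReal (phi nr (p.2 - H.mulVec p.1))) (x, y)) (H.mulVec x))
  refine lintegral_congr fun z => ?_
  simp only [Set.indicator, add_sub_cancel_left]
  rfl

lemma jointLaw_map_fst (H : Matrix (Fin nr) (Fin nt) ℝ) (μ : Measure (Fin nt → ℝ)) [IsProbabilityMeasure μ] :
    (jointLaw H μ).map Prod.fst = μ := by
  rw [jointLaw, Measure.map_map measurable_fst (measurable_shear H)]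
  exact (Measure.map_fst_prod).trans (by simp)

lemma jointLaw_map_snd (H : Matrix (Fin nr) (Fin nt) ℝ) (μ : Measure (Fin nt → ℝ)) [IsProbabilityMeasure μ] :
    (jointLaw H μ).map Prod.snd = volume.withDensity (fY H μ) := by
  ext s hs
  rw [Measure.map_apply measurable_snd hs, jointLaw_eq, withDensity_apply _ (measurable_snd hs),
    withDensity_apply _ hs, ← lintegral_indicator (measurable_snd hs),
    lintegral_prod_symm _ ((measurable_ker H).indicator (measurable_snd hs)).aemeasurable,
    ← lintegral_indicator hs]
  refine lintegral_congr fun y => ?_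
  by_cases hy : y ∈ s
  · simp [hy, fY, Set.indicator]
  · simp [hy, Set.indicator]

lemma phi_le (n : ℕ) (z : Fin n → ℝ) : phi n z ≤ Real.exp (-(n / 2) * Real.log (2 * Real.pi)) := by
  rw [phi_eq]
  apply Real.exp_le_exp.2
  have : 0 ≤ (∑ i, z i ^ 2) / 2 := by positivity
  linarith

lemma fY_le (H : Matrix (Fin nr) (Fin nt) ℝ) (μ : Measure (Fin nt → ℝ)) [IsProbabilityMeasure μ]
    (y : Fin nr → ℝ) : fY H μ y ≤ ENNReal.ofReal (Real.exp (-(nr / 2) * Real.log (2 * Real.pi))) := by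
  unfold fY
  calc _ ≤ ∫⁻ x, ENNReal.ofReal (Real.exp (-(nr / 2) * Real.log (2 * Real.pi))) ∂μ :=
        lintegral_mono fun x => ENNReal.ofReal_le_ofReal (phi_le _ _)
    _ = _ := by simp

lemma fY_ne_top (H : Matrix (Fin nr) (Fin nt) ℝ) (μ : Measure (Fin nt → ℝ)) [IsProbabilityMeasure μ]
    (y : Fin nr → ℝ) : fY H μ y ≠ ⊤ := ne_top_of_le_ne_top ENNReal.ofReal_ne_top (fY_le H μ y)

lemma fY_ne_zero (H : Matrix (Fin nr) (Fin nt) ℝ) (μ : Measure (Fin nt → ℝ)) [IsProbabilityMeasure μ]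
    (y : Fin nr → ℝ) : fY H μ y ≠ 0 := by
  unfold fY
  intro h
  have hm : Measurable fun x => ENNReal.ofReal (phi nr (y - H.mulVec x)) := by
    have h1 : Measurable fun x => y - H.mulVec x := measurable_const.sub (measurable_mulVec H)
    exact ((measurable_phi nr).comp h1).ennreal_ofReal
  rw [lintegral_eq_zero_iff hm] at h
  have : ∀ᵐ x ∂μ, False := by
    filter_upwards [h] with x hx
    have := phi_pos nr (y - H.mulVec x)
    simp at hx
    linarith
  exact IsProbabilityMeasure.ne_zero μ (by simpa using this)

lemma fY_toReal_pos (H : Matrix (Fin nr) (Fin nt) ℝ) (μ : Measure (Fin nt → ℝ)) [IsProbabilityMeasure μ]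
    (y : Fin nr → ℝ) : 0 < (fY H μ y).toReal :=
  ENNReal.toReal_pos (fY_ne_zero H μ y) (fY_ne_top H μ y)

lemma mutualInfo_eq (H : Matrix (Fin nr) (Fin nt) ℝ) (μ : Measure (Fin nt → ℝ)) [IsProbabilityMeasure μ] :
    mutualInfoJoint (jointLaw H μ) =
      ∫ p, (Real.log (phi nr p.2) - Real.log (fY H μ (H.mulVec p.1 + p.2)).toReal)
        ∂(μ.prod (stdGaussian nr)) := by
  unfold mutualInfoJoint klDivR
  rw [jointLaw_map_fst, jointLaw_map_snd]
  have hf := measurable_fY H μ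
  have hk := measurable_ker H
  have hfs : Measurable fun p : (Fin nt → ℝ) × (Fin nr → ℝ) => fY H μ p.2 := hf.comp measurable_snd
  have : SigmaFinite ((volume : Measure (Fin nr → ℝ)).withDensity (fY H μ)) :=
    SigmaFinite.withDensity_of_ne_top (Eventually.of_forall fun y => fY_ne_top H μ y)
  have hd : Measurable fun p : (Fin nt → ℝ) × (Fin nr → ℝ) =>
      ENNReal.ofReal (phi nr (p.2 - H.mulVec p.1)) / fY H μ p.2 := hk.div hfs
  have hpi : jointLaw H μ = (μ.prod (volume.withDensity (fY H μ))).withDensity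
      (fun p => ENNReal.ofReal (phi nr (p.2 - H.mulVec p.1)) / fY H μ p.2) := by
    rw [prod_withDensity_right hf, ← withDensity_mul _ hfs hd, jointLaw_eq]
    congr 1
    ext p
    exact (ENNReal.mul_div_cancel (fY_ne_zero H μ _) (fY_ne_top H μ _)).symm
  have hrn : (jointLaw H μ).rnDeriv (μ.prod (volume.withDensity (fY H μ)))
      =ᵐ[jointLaw H μ] (fun p => ENNReal.ofReal (phi nr (p.2 - H.mulVec p.1)) / fY H μ p.2) := by
    have hac : jointLaw H μ ≪ μ.prod (volume.withDensity (fY H μ)) := by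
      rw [hpi]; exact withDensity_absolutelyContinuous _ _
    refine hac.ae_le ?_
    nth_rw 1 [hpi]
    exact Measure.rnDeriv_withDensity _ hd
  have h1 : ∫ ω, Real.log ((jointLaw H μ).rnDeriv (μ.prod (volume.withDensity (fY H μ))) ω).toReal ∂(jointLaw H μ)
     = ∫ p, (Real.log (phi nr (p.2 - H.mulVec p.1)) - Real.log (fY H μ p.2).toReal) ∂(jointLaw H μ) := by
    refine integral_congr_ae ?_
    filter_upwards [hrn] with p hp
    rw [hp, ENNReal.toReal_div, ENNReal.toReal_ofReal (phi_pos _ _).le,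
      Real.log_div (phi_pos _ _).ne' (fY_toReal_pos H μ _).ne']
  rw [h1, jointLaw, integral_map (measurable_shear H).aemeasurable]
  · simp
  · apply Measurable.aestronglyMeasurable
    have := measurable_mulVec H
    have := measurable_phi nr
    fun_prop

end MimoOptical

namespace MimoOptical
variable {nt nr : ℕ}

lemma exists_box_bound (H : Matrix (Fin nr) (Fin nt) ℝ) (A : ℝ) :
    ∃ R : ℝ, ∀ x x' : Fin nt → ℝ, (∀ k, x k ∈ Set.Icc (0 : ℝ) A) → (∀ k, x' k ∈ Set.Icc (0 : ℝ) A) →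
      ∑ i, (H.mulVec x' i - H.mulVec x i) ^ 2 ≤ R := by
  have hc : IsCompact (Set.univ.pi fun _ : Fin nt => Set.Icc (0 : ℝ) A) := isCompact_univ_pi fun _ => isCompact_Icc
  obtain ⟨R, hR⟩ := (hc.prod hc).exists_bound_of_continuousOn
    (f := fun p : (Fin nt → ℝ) × (Fin nt → ℝ) => ∑ i, (H.mulVec p.2 i - H.mulVec p.1 i) ^ 2)
    (Continuous.continuousOn (by fun_prop))
  refine ⟨R, fun x x' hx hx' => ?_⟩
  have := hR (x, x') ⟨fun k _ => hx k, fun k _ => hx' k⟩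
  exact (le_abs_self _).trans this

lemma fY_lower (H : Matrix (Fin nr) (Fin nt) ℝ) (A R : ℝ) (μ : Measure (Fin nt → ℝ)) [IsProbabilityMeasure μ]
    (hμ : ∀ᵐ x ∂μ, ∀ k, x k ∈ Set.Icc (0 : ℝ) A)
    (hR : ∀ x x' : Fin nt → ℝ, (∀ k, x k ∈ Set.Icc (0 : ℝ) A) → (∀ k, x' k ∈ Set.Icc (0 : ℝ) A) →
      ∑ i, (H.mulVec x' i - H.mulVec x i) ^ 2 ≤ R)
    (x' : Fin nt → ℝ) (hx' : ∀ k, x' k ∈ Set.Icc (0 : ℝ) A) (z : Fin nr → ℝ) :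
    -(nr / 2) * Real.log (2 * Real.pi) - ∑ i, z i ^ 2 - R ≤ Real.log (fY H μ (H.mulVec x' + z)).toReal := by
  rw [Real.le_log_iff_exp_le (fY_toReal_pos _ _ _)]
  rw [← ENNReal.ofReal_le_iff_le_toReal (fY_ne_top _ _ _)]
  set c := Real.exp (-(nr / 2) * Real.log (2 * Real.pi) - ∑ i, z i ^ 2 - R)
  calc ENNReal.ofReal c = ∫⁻ x, ENNReal.ofReal c ∂μ := by simp
    _ ≤ _ := by
      unfold fY
      refine lintegral_mono_ae ?_
      filter_upwards [hμ] with x hx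
      apply ENNReal.ofReal_le_ofReal
      rw [phi_eq]
      apply Real.exp_le_exp.2
      have h1 := hR x x' hx hx'
      have h2 : ∑ i, (H.mulVec x' + z - H.mulVec x) i ^ 2
          ≤ ∑ i, (2 * (H.mulVec x' i - H.mulVec x i) ^ 2 + 2 * z i ^ 2) := by
        refine Finset.sum_le_sum fun i _ => ?_
        simp only [Pi.add_apply, Pi.sub_apply]
        nlinarith [sq_nonneg (H.mulVec x' i - H.mulVec x i - z i)]
      rw [Finset.sum_add_distrib, ← Finset.mul_sum, ← Finset.mul_sum] at h2
      linarith

lemma log_fY_upper (H : Matrix (Fin nr) (Fin nt) ℝ) (μ : Measure (Fin nt → ℝ)) [IsProbabilityMeasure μ]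
    (y : Fin nr → ℝ) : Real.log (fY H μ y).toReal ≤ -(nr / 2) * Real.log (2 * Real.pi) := by
  rw [Real.log_le_iff_le_exp (fY_toReal_pos _ _ _)]
  exact ENNReal.toReal_le_of_le_ofReal (Real.exp_pos _).le (fY_le H μ y)

lemma ae_prod_box (A : ℝ) (μ : Measure (Fin nt → ℝ)) [IsProbabilityMeasure μ]
    (hμ : ∀ᵐ x ∂μ, ∀ k, x k ∈ Set.Icc (0 : ℝ) A) :
    ∀ᵐ p ∂(μ.prod (stdGaussian nr)), ∀ k, p.1 k ∈ Set.Icc (0 : ℝ) A :=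
  Measure.quasiMeasurePreserving_fst.ae hμ

lemma integrable_sumsq_prod (μ : Measure (Fin nt → ℝ)) [IsProbabilityMeasure μ] :
    Integrable (fun p : (Fin nt → ℝ) × (Fin nr → ℝ) => ∑ i, p.2 i ^ 2) (μ.prod (stdGaussian nr)) ∧
    ∫ p, ∑ i, p.2 i ^ 2 ∂(μ.prod (stdGaussian nr)) = nr := by
  constructor
  · exact (integral_sumsq_gaussian nr).1.comp_snd μ
  · have := integral_fun_snd (μ := μ) (ν := stdGaussian nr) (fun z : Fin nr → ℝ => ∑ i, z i ^ 2)
    rw [this, (integral_sumsq_gaussian nr).2]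
    simp

lemma integrable_log_phi (μ : Measure (Fin nt → ℝ)) [IsProbabilityMeasure μ] :
    Integrable (fun p : (Fin nt → ℝ) × (Fin nr → ℝ) => Real.log (phi nr p.2)) (μ.prod (stdGaussian nr)) ∧
    ∫ p, Real.log (phi nr p.2) ∂(μ.prod (stdGaussian nr)) =
      -(nr / 2) * Real.log (2 * Real.pi) - nr / 2 := by
  have h := integrable_sumsq_prod (nr := nr) μ
  simp only [log_phi]
  constructor
  · exact (integrable_const _).sub (h.1.div_const _)
  · rw [integral_sub (integrable_const _) (h.1.div_const _), integral_div, h.2]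
    simp

lemma measurable_log_fY (H : Matrix (Fin nr) (Fin nt) ℝ) (μ : Measure (Fin nt → ℝ)) [IsProbabilityMeasure μ] :
    Measurable (fun p : (Fin nt → ℝ) × (Fin nr → ℝ) => Real.log (fY H μ (H.mulVec p.1 + p.2)).toReal) := by
  have := measurable_mulVec H
  have := measurable_fY H μ
  fun_prop

lemma integrable_log_fY (H : Matrix (Fin nr) (Fin nt) ℝ) (A : ℝ) (μ : Measure (Fin nt → ℝ))
    [IsProbabilityMeasure μ] (hμ : ∀ᵐ x ∂μ, ∀ k, x k ∈ Set.Icc (0 : ℝ) A) :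
    Integrable (fun p : (Fin nt → ℝ) × (Fin nr → ℝ) => Real.log (fY H μ (H.mulVec p.1 + p.2)).toReal)
      (μ.prod (stdGaussian nr)) := by
  obtain ⟨R, hR⟩ := exists_box_bound H A
  have h := integrable_sumsq_prod (nr := nr) μ
  refine Integrable.mono' (g := fun p => |-(nr / 2) * Real.log (2 * Real.pi)| + |R| + ∑ i, p.2 i ^ 2)
    ((integrable_const _).add h.1) (measurable_log_fY H μ).aestronglyMeasurable ?_
  filter_upwards [ae_prod_box (nr := nr) A μ hμ] with p hp
  have h1 := fY_lower H A R μ hμ hR p.1 hp p.2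
  have h2 := log_fY_upper H μ (H.mulVec p.1 + p.2)
  have h3 : 0 ≤ ∑ i, p.2 i ^ 2 := by positivity
  have h4 := abs_le.1 (le_refl |-(nr / 2) * Real.log (2 * Real.pi)|)
  rw [Real.norm_eq_abs, abs_le]
  constructor <;> linarith [le_abs_self R, abs_nonneg R]

/-- Lower bound on the mutual information when `HX` has density at most `K`. -/
lemma mutualInfo_ge (H : Matrix (Fin nr) (Fin nt) ℝ) (A : ℝ) (μ : Measure (Fin nt → ℝ))
    [IsProbabilityMeasure μ] (hμ : ∀ᵐ x ∂μ, ∀ k, x k ∈ Set.Icc (0 : ℝ) A) (K : ℝ) (hK : 0 < K)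
    (hle : μ.map (fun x => H.mulVec x) ≤ ENNReal.ofReal K • volume) :
    -(nr / 2) * Real.log (2 * Real.pi) - nr / 2 - Real.log K ≤ mutualInfoJoint (jointLaw H μ) := by
  have hf : ∀ y, fY H μ y ≤ ENNReal.ofReal K := by
    intro y
    have hm : Measurable fun u : Fin nr → ℝ => ENNReal.ofReal (phi nr (y - u)) := by
      exact ((measurable_phi nr).comp (measurable_const.sub measurable_id)).ennreal_ofReal
    calc fY H μ y = ∫⁻ u, ENNReal.ofReal (phi nr (y - u)) ∂(μ.map (fun x => H.mulVec x)) := by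
          rw [lintegral_map hm (measurable_mulVec H)]; rfl
      _ ≤ ∫⁻ u, ENNReal.ofReal (phi nr (y - u)) ∂(ENNReal.ofReal K • (volume : Measure (Fin nr → ℝ))) :=
          lintegral_mono' hle le_rfl
      _ = ENNReal.ofReal K * ∫⁻ u, ENNReal.ofReal (phi nr (y - u)) := by
          rw [lintegral_smul_measure]; rfl
      _ = ENNReal.ofReal K * ∫⁻ u, ENNReal.ofReal (phi nr u) := by
          rw [lintegral_sub_left_eq_self (fun u => ENNReal.ofReal (phi nr u)) y]
      _ = ENNReal.ofReal K := by
          have : ∫⁻ u, ENNReal.ofReal (phi nr u) = 1 := by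
            have := measure_univ (μ := stdGaussian nr)
            rwa [stdGaussian_eq, withDensity_apply _ MeasurableSet.univ, Measure.restrict_univ] at this
          rw [this, mul_one]
  have h1 := integrable_log_phi (nr := nr) μ
  have h2 := integrable_log_fY H A μ hμ
  rw [mutualInfo_eq, integral_sub h1.1 h2, h1.2]
  have h3 : ∫ p, Real.log (fY H μ (H.mulVec p.1 + p.2)).toReal ∂(μ.prod (stdGaussian nr))
      ≤ ∫ p, Real.log K ∂(μ.prod (stdGaussian nr)) := by
    refine integral_mono h2 (integrable_const _) fun p => ?_
    exact Real.log_le_log (fY_toReal_pos _ _ _) (ENNReal.toReal_le_of_le_ofReal hK.le (hf _))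
  simp at h3
  linarith

/-- Upper bound on the mutual information through a test density. -/
lemma mutualInfo_le (H : Matrix (Fin nr) (Fin nt) ℝ) (A : ℝ) (μ : Measure (Fin nt → ℝ))
    [IsProbabilityMeasure μ] (hμ : ∀ᵐ x ∂μ, ∀ k, x k ∈ Set.Icc (0 : ℝ) A)
    (r : (Fin nr → ℝ) → ℝ) (hrm : Measurable r) (hr : ∀ y, 0 < r y)
    (hr1 : ∫⁻ y, ENNReal.ofReal (r y) ≤ 1) (b k : ℝ)
    (hb : ∀ x z, (∀ k, x k ∈ Set.Icc (0 : ℝ) A) → -Real.log (r (H.mulVec x + z)) ≤ b + k * ∑ i, z i ^ 2) :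
    mutualInfoJoint (jointLaw H μ) ≤ -(nr / 2) * Real.log (2 * Real.pi) - nr / 2 + b + k * nr := by
  have h1 := integrable_log_phi (nr := nr) μ
  have h2 := integrable_log_fY H A μ hμ
  have hs := integrable_sumsq_prod (nr := nr) μ
  have hfm := measurable_fY H μ
  have hHm := measurable_mulVec H
  set P := μ.prod (stdGaussian nr)
  have hq : ∫⁻ p, ENNReal.ofReal (r (H.mulVec p.1 + p.2) / (fY H μ (H.mulVec p.1 + p.2)).toReal) ∂P ≤ 1 := by
    have hm : Measurable fun y => ENNReal.ofReal (r y / (fY H μ y).toReal) := by fun_prop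
    have e1 : ∫⁻ p, ENNReal.ofReal (r (H.mulVec p.1 + p.2) / (fY H μ (H.mulVec p.1 + p.2)).toReal) ∂P
        = ∫⁻ y, ENNReal.ofReal (r y / (fY H μ y).toReal) ∂((jointLaw H μ).map Prod.snd) := by
      rw [lintegral_map hm measurable_snd, jointLaw, lintegral_map (by fun_prop) (measurable_shear H)]
    rw [e1, jointLaw_map_snd, lintegral_withDensity_eq_lintegral_mul _ hfm hm]
    refine le_trans (le_of_eq ?_) hr1
    refine lintegral_congr fun y => ?_
    simp only [Pi.mul_apply]
    rw [ENNReal.ofReal_div_of_pos (fY_toReal_pos H μ y), ENNReal.ofReal_toReal (fY_ne_top H μ y)]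
    exact ENNReal.mul_div_cancel (fY_ne_zero H μ _) (fY_ne_top H μ _)
  have hqpos : ∀ p : (Fin nt → ℝ) × (Fin nr → ℝ),
      0 ≤ r (H.mulVec p.1 + p.2) / (fY H μ (H.mulVec p.1 + p.2)).toReal := fun p =>
    div_nonneg (hr _).le ENNReal.toReal_nonneg
  have hqm : Measurable fun p : (Fin nt → ℝ) × (Fin nr → ℝ) =>
      r (H.mulVec p.1 + p.2) / (fY H μ (H.mulVec p.1 + p.2)).toReal := by fun_prop
  have hqi : Integrable (fun p : (Fin nt → ℝ) × (Fin nr → ℝ) =>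
      r (H.mulVec p.1 + p.2) / (fY H μ (H.mulVec p.1 + p.2)).toReal) P := by
    refine ⟨hqm.aestronglyMeasurable, ?_⟩
    rw [hasFiniteIntegral_iff_ofReal (Eventually.of_forall hqpos)]
    exact lt_of_le_of_lt hq ENNReal.one_lt_top
  have hq' : ∫ p, r (H.mulVec p.1 + p.2) / (fY H μ (H.mulVec p.1 + p.2)).toReal ∂P ≤ 1 := by
    rw [integral_eq_lintegral_of_nonneg_ae (Eventually.of_forall hqpos) hqm.aestronglyMeasurable]
    exact ENNReal.toReal_le_of_le_ofReal zero_le_one (by simpa using hq)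
  rw [mutualInfo_eq, integral_sub h1.1 h2, h1.2]
  have h3 : ∫ p, (-(b + k * ∑ i, p.2 i ^ 2)
      - (r (H.mulVec p.1 + p.2) / (fY H μ (H.mulVec p.1 + p.2)).toReal - 1)) ∂P
      ≤ ∫ p, Real.log (fY H μ (H.mulVec p.1 + p.2)).toReal ∂P := by
    refine integral_mono_ae ((((integrable_const _).add (hs.1.const_mul _)).neg).sub
      (hqi.sub (integrable_const _))) h2 ?_
    filter_upwards [ae_prod_box (nr := nr) A μ hμ] with p hp
    have h4 := hb p.1 p.2 hp
    have hf0 := fY_toReal_pos H μ (H.mulVec p.1 + p.2)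
    have h5 := Real.log_le_sub_one_of_pos (div_pos (hr (H.mulVec p.1 + p.2)) hf0)
    rw [Real.log_div (hr _).ne' hf0.ne'] at h5
    linarith
  have i1 : Integrable (fun p : (Fin nt → ℝ) × (Fin nr → ℝ) => -(b + k * ∑ i, p.2 i ^ 2)) P :=
    ((integrable_const _).add (hs.1.const_mul _)).neg
  have i2 : Integrable (fun p : (Fin nt → ℝ) × (Fin nr → ℝ) =>
      r (H.mulVec p.1 + p.2) / (fY H μ (H.mulVec p.1 + p.2)).toReal - 1) P :=
    hqi.sub (integrable_const _)
  rw [integral_sub i1 i2, integral_neg, integral_add (integrable_const _) (hs.1.const_mul _),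
    integral_sub hqi (integrable_const _), integral_const_mul, hs.2] at h3
  simp at h3
  linarith

end MimoOptical

namespace MimoOptical
variable {nt nr : ℕ}

/-- Unnormalized test density. -/
def wS {n : ℕ} (S : Set (Fin n → ℝ)) (l : ℝ) (y : Fin n → ℝ) : ℝ :=
  Real.exp (-l * Metric.infDist y S ^ 2)

lemma wS_pos {n : ℕ} (S : Set (Fin n → ℝ)) (l : ℝ) (y : Fin n → ℝ) : 0 < wS S l y := Real.exp_pos _

lemma continuous_wS {n : ℕ} (S : Set (Fin n → ℝ)) (l : ℝ) : Continuous (wS S l) := by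
  have := Metric.continuous_infDist_pt S
  unfold wS
  fun_prop

lemma integrable_wS_one {n : ℕ} (hn : 1 ≤ n) (S : Set (Fin n → ℝ)) (hS : IsCompact S) (hne : S.Nonempty) :
    Integrable (wS S 1) := by
  obtain ⟨R, hR⟩ := hS.isBounded.exists_norm_le
  have hn' : (0 : ℝ) < n := by exact_mod_cast hn
  have hg : Integrable (fun y : Fin n → ℝ => Real.exp (R ^ 2) * ∏ i, Real.exp (-(1 / (2 * n)) * y i ^ 2)) := by
    refine Integrable.const_mul ?_ _
    exact Integrable.fintype_prod (f := fun _ x => Real.exp (-(1 / (2 * (n : ℝ))) * x ^ 2))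
      fun i => integrable_exp_neg_mul_sq (by positivity)
  refine hg.mono' (continuous_wS S 1).aestronglyMeasurable (Eventually.of_forall fun y => ?_)
  rw [Real.norm_of_nonneg (wS_pos _ _ _).le, wS, ← Real.exp_sum, ← Real.exp_add]
  apply Real.exp_le_exp.2
  obtain ⟨s, hs, hd⟩ := hS.exists_infDist_eq_dist hne y
  have h1 : ‖y‖ ≤ Metric.infDist y S + R := by
    rw [hd, dist_eq_norm]
    calc ‖y‖ = ‖(y - s) + s‖ := by simp
      _ ≤ ‖y - s‖ + ‖s‖ := norm_add_le _ _
      _ ≤ _ := by linarith [hR s hs]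
  have h2 : ∑ i, -(1 / (2 * (n : ℝ))) * y i ^ 2 ≥ -‖y‖ ^ 2 / 2 := by
    calc ∑ i, -(1 / (2 * (n : ℝ))) * y i ^ 2 ≥ ∑ i : Fin n, -(1 / (2 * (n : ℝ))) * ‖y‖ ^ 2 := by
          refine Finset.sum_le_sum fun i _ => ?_
          have h3 : y i ^ 2 ≤ ‖y‖ ^ 2 := by
            rw [← sq_abs (y i)]
            exact pow_le_pow_left₀ (abs_nonneg _) (norm_le_pi_norm y i) 2
          have : 0 ≤ 1 / (2 * (n : ℝ)) := by positivity
          nlinarith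
      _ = -‖y‖ ^ 2 / 2 := by
          simp
          field_simp
  have h4 : 0 ≤ Metric.infDist y S := Metric.infDist_nonneg
  have h5 : ‖y‖ ^ 2 ≤ (Metric.infDist y S + R) ^ 2 := pow_le_pow_left₀ (norm_nonneg _) h1 2
  nlinarith [sq_nonneg (Metric.infDist y S - R)]

lemma integrable_wS {n : ℕ} (hn : 1 ≤ n) (S : Set (Fin n → ℝ)) (hS : IsCompact S) (hne : S.Nonempty)
    (l : ℝ) (hl : 1 ≤ l) : Integrable (wS S l) := by
  refine (integrable_wS_one hn S hS hne).mono' (continuous_wS S l).aestronglyMeasurable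
    (Eventually.of_forall fun y => ?_)
  rw [Real.norm_of_nonneg (wS_pos _ _ _).le]
  apply Real.exp_le_exp.2
  nlinarith [sq_nonneg (Metric.infDist y S)]

lemma tendsto_wS {n : ℕ} (hn : 1 ≤ n) (S : Set (Fin n → ℝ)) (hS : IsCompact S) (hne : S.Nonempty) :
    Tendsto (fun m : ℕ => ∫ y, wS S (m + 1) y) atTop (nhds (volume.real S)) := by
  have h1 : volume.real S = ∫ y, S.indicator (fun _ => (1 : ℝ)) y := by
    rw [integral_indicator hS.measurableSet]; simp
  rw [h1]
  refine tendsto_integral_of_dominated_convergence (wS S 1)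
    (fun m => (continuous_wS S _).aestronglyMeasurable) (integrable_wS_one hn S hS hne) ?_ ?_
  · refine fun m => Eventually.of_forall fun y => ?_
    rw [Real.norm_of_nonneg (wS_pos _ _ _).le]
    apply Real.exp_le_exp.2
    have : (0 : ℝ) ≤ m := Nat.cast_nonneg m
    nlinarith [mul_nonneg this (sq_nonneg (Metric.infDist y S))]
  · refine Eventually.of_forall fun y => ?_
    by_cases hy : y ∈ S
    · simp [wS, hy, Metric.infDist_zero_of_mem hy]
    · have hd : 0 < Metric.infDist y S := (hS.isClosed.notMem_iff_infDist_pos hne).1 hy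
      simp only [Set.indicator_of_notMem hy, wS]
      refine Real.tendsto_exp_atBot.comp ?_
      refine Tendsto.atBot_mul_const (pow_pos hd 2) ?_
      refine tendsto_neg_atTop_atBot.comp ?_
      exact tendsto_atTop_add_const_right _ _ tendsto_natCast_atTop_atTop

/-- Upper bound for every admissible input. -/
lemma mutualInfo_le_wS (hnr : 1 ≤ nr) (H : Matrix (Fin nr) (Fin nt) ℝ) (A : ℝ) (hA : 0 < A)
    (μ : Measure (Fin nt → ℝ))
    [IsProbabilityMeasure μ] (hμ : ∀ᵐ x ∂μ, ∀ k, x k ∈ Set.Icc (0 : ℝ) A)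
    (S : Set (Fin nr → ℝ)) (hS : IsCompact S) (hne : S.Nonempty) (hSz : zonotope H 1 ⊆ S) (l : ℝ) (hl : 1 ≤ l) :
    mutualInfoJoint (jointLaw H μ) ≤ -(nr / 2) * Real.log (2 * Real.pi) - nr / 2
      + (nr * Real.log A + Real.log (∫ y, wS S l y)) + l / A ^ 2 * nr := by
  set K := ∫ y, wS S l y with hK
  have hi := integrable_wS hnr S hS hne l hl
  have hKpos : 0 < K := by
    rw [hK, integral_pos_iff_support_of_nonneg (fun y => (wS_pos S l y).le) hi]
    have : Function.support (wS S l) = Set.univ := by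
      ext y; simpa using (wS_pos S l y).ne'
    rw [this]; exact isOpen_univ.measure_pos volume Set.univ_nonempty
  have hAn : 0 < A ^ nr := pow_pos hA _
  have hsc : ∫ y, wS S l (A⁻¹ • y) = A ^ nr * K := by
    rw [Measure.integral_comp_inv_smul_of_nonneg volume (wS S l) hA.le]
    simp [hK]
  have hi' : Integrable fun y => wS S l (A⁻¹ • y) := hi.comp_smul (inv_ne_zero hA.ne')
  refine mutualInfo_le H A μ hμ (fun y => wS S l (A⁻¹ • y) / (A ^ nr * K)) ?_ ?_ ?_ _ _ ?_
  · have := (continuous_wS S l).measurable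
    fun_prop
  · intro y
    exact div_pos (wS_pos _ _ _) (by positivity)
  · rw [← ofReal_integral_eq_lintegral_ofReal (hi'.div_const _)
      (Eventually.of_forall fun y => (div_pos (wS_pos _ _ _) (by positivity)).le),
      integral_div, hsc, div_self (by positivity)]
    simp
  · intro x z hx
    rw [Real.log_div (wS_pos _ _ _).ne' (by positivity), Real.log_mul hAn.ne' hKpos.ne', Real.log_pow,
      wS, Real.log_exp]
    have hmem : A⁻¹ • H.mulVec x ∈ S := by
      apply hSz
      refine ⟨A⁻¹ • x, fun i => ?_, by rw [Matrix.mulVec_smul]⟩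
      have := hx i
      simp only [Pi.smul_apply, smul_eq_mul, Set.mem_Icc]
      refine ⟨mul_nonneg (inv_nonneg.2 hA.le) this.1, ?_⟩
      rw [inv_mul_le_iff₀ hA]; linarith [this.2]
    have h1 : Metric.infDist (A⁻¹ • (H.mulVec x + z)) S ≤ A⁻¹ * ‖z‖ := by
      refine (Metric.infDist_le_dist_of_mem hmem).trans (le_of_eq ?_)
      rw [dist_eq_norm, smul_add, add_sub_cancel_left, norm_smul, Real.norm_of_nonneg (inv_nonneg.2 hA.le)]
    have h2 : ‖z‖ ^ 2 ≤ ∑ i, z i ^ 2 := by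
      have h3 : ‖z‖ ≤ Real.sqrt (∑ i, z i ^ 2) := by
        refine (pi_norm_le_iff_of_nonneg (Real.sqrt_nonneg _)).2 fun i => ?_
        rw [Real.norm_eq_abs, ← Real.sqrt_sq_eq_abs]
        exact Real.sqrt_le_sqrt (Finset.single_le_sum (f := fun i => z i ^ 2) (fun j _ => sq_nonneg _) (Finset.mem_univ i))
      calc ‖z‖ ^ 2 ≤ Real.sqrt (∑ i, z i ^ 2) ^ 2 := pow_le_pow_left₀ (norm_nonneg _) h3 2
        _ = _ := Real.sq_sqrt (by positivity)
    have h4 : Metric.infDist (A⁻¹ • (H.mulVec x + z)) S ^ 2 ≤ (A ^ 2)⁻¹ * ∑ i, z i ^ 2 := by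
      calc _ ≤ (A⁻¹ * ‖z‖) ^ 2 := pow_le_pow_left₀ Metric.infDist_nonneg h1 2
        _ = (A ^ 2)⁻¹ * ‖z‖ ^ 2 := by rw [mul_pow, inv_pow]
        _ ≤ _ := by gcongr
    have h5 := mul_le_mul_of_nonneg_left h4 (by linarith : 0 ≤ l)
    rw [div_eq_mul_inv]
    nlinarith

end MimoOptical

namespace MimoOptical
variable {nt nr : ℕ}

/-- Extend coordinates on `U` by given values outside `U`. -/
def extU (U : Finset (Fin nt)) (t : Fin nr → ℝ) (g : Fin nt → ℝ) : Fin nt → ℝ :=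
  if h : U.card = nr then Function.extend (U.orderEmbOfFin h) t g else g

lemma extU_mem (U : Finset (Fin nt)) (h : U.card = nr) (t : Fin nr → ℝ) (g : Fin nt → ℝ) (i : Fin nr) :
    extU U t g (U.orderEmbOfFin h i) = t i := by
  rw [extU, dif_pos h]
  exact (U.orderEmbOfFin h).injective.extend_apply _ _ _

lemma extU_notMem (U : Finset (Fin nt)) (t : Fin nr → ℝ) (g : Fin nt → ℝ) (j : Fin nt) (hj : j ∉ U) :
    extU U t g j = g j := by
  unfold extU
  split_ifs with h
  · refine Function.extend_apply' _ _ _ ?_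
    rintro ⟨i, rfl⟩
    exact hj (Finset.orderEmbOfFin_mem U h i)
  · rfl

lemma exists_emb (U : Finset (Fin nt)) (h : U.card = nr) (k : Fin nt) (hk : k ∈ U) :
    ∃ i, U.orderEmbOfFin h i = k := by
  have : k ∈ Set.range (U.orderEmbOfFin h) := by rw [Finset.range_orderEmbOfFin]; exact hk
  exact this

lemma sum_split {M : Type*} [AddCommMonoid M] (U : Finset (Fin nt)) (h : U.card = nr) (f : Fin nt → M) :
    ∑ k, f k = ∑ i, f (U.orderEmbOfFin h i) + ∑ j ∈ Uᶜ, f j := by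
  rw [← Finset.sum_add_sum_compl U f]
  congr 1
  conv_lhs => rw [← Finset.map_orderEmbOfFin_univ U h, Finset.sum_map]
  rfl

lemma HU_eq (H : Matrix (Fin nr) (Fin nt) ℝ) (U : Finset (Fin nt)) (h : U.card = nr) :
    HU H U = H.submatrix id (fun i => U.orderEmbOfFin h i) := by
  rw [HU, dif_pos h]

lemma mulVec_split (H : Matrix (Fin nr) (Fin nt) ℝ) (U : Finset (Fin nt)) (h : U.card = nr) (x : Fin nt → ℝ) :
    H.mulVec x = (HU H U).mulVec (fun i => x (U.orderEmbOfFin h i)) + ∑ j ∈ Uᶜ, x j • (fun r => H r j) := by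
  ext r
  simp only [Matrix.mulVec, dotProduct, Pi.add_apply, Finset.sum_apply, Pi.smul_apply, smul_eq_mul]
  rw [sum_split U h, HU_eq H U h]
  simp [mul_comm]

lemma det_ne_zero (H : Matrix (Fin nr) (Fin nt) ℝ) (U : Finset (Fin nt)) (hU : U ∈ goodSets H) :
    (HU H U).det ≠ 0 := by
  obtain ⟨h, hli⟩ := hU
  have h1 : LinearIndependent ℝ (HU H U).col := by
    rw [HU_eq H U h]
    exact hli.comp (fun i => ⟨U.orderEmbOfFin h i, Finset.orderEmbOfFin_mem U h i⟩)
      (fun i j hij => (U.orderEmbOfFin h).injective (Subtype.ext_iff.1 hij))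
  rw [linearIndependent_cols_iff_isUnit, Matrix.isUnit_iff_isUnit_det] at h1
  exact h1.ne_zero

lemma inv_mulVec_split (H : Matrix (Fin nr) (Fin nt) ℝ) (U : Finset (Fin nt)) (hU : U ∈ goodSets H)
    (x : Fin nt → ℝ) :
    (HU H U)⁻¹.mulVec (H.mulVec x) = (fun i => x (U.orderEmbOfFin hU.1 i))
      + ∑ j ∈ Uᶜ, x j • (HU H U)⁻¹.mulVec (fun r => H r j) := by
  have hd : IsUnit (HU H U).det := (det_ne_zero H U hU).isUnit
  rw [mulVec_split H U hU.1, Matrix.mulVec_add, Matrix.mulVec_mulVec, Matrix.nonsing_inv_mul _ hd,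
    Matrix.one_mulVec, Matrix.mulVec_sum]
  simp only [Matrix.mulVec_smul]

lemma sum_eq (H : Matrix (Fin nr) (Fin nt) ℝ) (U : Finset (Fin nt)) (hU : U ∈ goodSets H)
    (x : Fin nt → ℝ) :
    ∑ k, x k = ∑ i, (HU H U)⁻¹.mulVec (H.mulVec x) i + ∑ j ∈ Uᶜ, (1 - aUj H U j) * x j := by
  rw [inv_mulVec_split H U hU, sum_split U hU.1 x]
  simp only [Pi.add_apply, Finset.sum_apply, Pi.smul_apply, smul_eq_mul, Finset.sum_add_distrib]
  rw [Finset.sum_comm, add_assoc, ← Finset.sum_add_distrib]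
  congr 1
  refine Finset.sum_congr rfl fun j _ => ?_
  rw [← Finset.mul_sum, aUj]
  ring

lemma eq_of_eq_compl (H : Matrix (Fin nr) (Fin nt) ℝ) (U : Finset (Fin nt)) (hU : U ∈ goodSets H)
    (x x' : Fin nt → ℝ) (hx : H.mulVec x = H.mulVec x') (hc : ∀ j ∉ U, x j = x' j) : x = x' := by
  have h1 := inv_mulVec_split H U hU x
  have h2 := inv_mulVec_split H U hU x'
  rw [hx, h2] at h1
  have h3 : ∑ j ∈ Uᶜ, x j • (HU H U)⁻¹.mulVec (fun r => H r j)
      = ∑ j ∈ Uᶜ, x' j • (HU H U)⁻¹.mulVec (fun r => H r j) := by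
    refine Finset.sum_congr rfl fun j hj => ?_
    rw [hc j (Finset.mem_compl.1 hj)]
  rw [h3] at h1
  have h4 := add_right_cancel h1
  ext k
  by_cases hk : k ∈ U
  · obtain ⟨i, rfl⟩ := exists_emb U hU.1 k hk
    exact (congrFun h4 i).symm
  · exact hc k hk

lemma gUj_mem (H : Matrix (Fin nr) (Fin nt) ℝ) (U : Finset (Fin nt)) (j : Fin nt) :
    gUj H U j = 0 ∨ gUj H U j = 1 := by
  unfold gUj; split_ifs <;> simp

/-- The point of the cube attached to local coordinates in the cell `U`. -/
def lamU (H : Matrix (Fin nr) (Fin nt) ℝ) (U : Finset (Fin nt)) (t : Fin nr → ℝ) : Fin nt → ℝ :=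
  extU U t (gUj H U)

def obox (n : ℕ) : Set (Fin n → ℝ) := Set.univ.pi fun _ => Set.Ioo (0 : ℝ) 1

lemma lamU_mem_Icc (H : Matrix (Fin nr) (Fin nt) ℝ) (U : Finset (Fin nt)) (hU : U.card = nr) (t : Fin nr → ℝ)
    (ht : t ∈ obox nr) (k : Fin nt) : lamU H U t k ∈ Set.Icc (0 : ℝ) 1 := by
  by_cases hk : k ∈ U
  · obtain ⟨i, rfl⟩ := exists_emb U hU k hk
    rw [lamU, extU_mem]
    exact Set.Ioo_subset_Icc_self (ht i trivial)
  · rw [lamU, extU_notMem _ _ _ _ hk]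
    rcases gUj_mem H U k with h | h <;> simp [h]

lemma lamU_frac (H : Matrix (Fin nr) (Fin nt) ℝ) (U : Finset (Fin nt)) (hU : U.card = nr) (t : Fin nr → ℝ)
    (ht : t ∈ obox nr) (k : Fin nt) : k ∈ U ↔ lamU H U t k ∈ Set.Ioo (0 : ℝ) 1 := by
  by_cases hk : k ∈ U
  · obtain ⟨i, rfl⟩ := exists_emb U hU k hk
    rw [lamU, extU_mem]
    exact iff_of_true hk (ht i trivial)
  · rw [lamU, extU_notMem _ _ _ _ hk]
    rcases gUj_mem H U k with h | h <;> simp [h, hk]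

lemma lamU_unique (H : Matrix (Fin nr) (Fin nt) ℝ) (U : Finset (Fin nt)) (hU : U ∈ goodSets H)
    (htie : ∀ j ∉ U, aUj H U j ≠ 1) (t : Fin nr → ℝ)
    (x : Fin nt → ℝ) (hx : ∀ k, x k ∈ Set.Icc (0 : ℝ) 1) (hHx : H.mulVec x = H.mulVec (lamU H U t))
    (hle : ∑ k, x k ≤ ∑ k, lamU H U t k) : x = lamU H U t := by
  have h1 := sum_eq H U hU x
  have h2 := sum_eq H U hU (lamU H U t)
  rw [hHx] at h1
  have hterm : ∀ j ∈ Uᶜ, (1 - aUj H U j) * lamU H U t j ≤ (1 - aUj H U j) * x j := by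
    intro j hj
    have hj' := Finset.mem_compl.1 hj
    rw [lamU, extU_notMem _ _ _ _ hj', gUj]
    have := hx j
    split_ifs with ha
    · nlinarith [this.1, this.2]
    · have : aUj H U j ≤ 1 := not_lt.1 ha
      nlinarith [(hx j).1]
  have hsum : ∑ j ∈ Uᶜ, (1 - aUj H U j) * lamU H U t j = ∑ j ∈ Uᶜ, (1 - aUj H U j) * x j :=
    le_antisymm (Finset.sum_le_sum hterm) (by linarith)
  have heq := (Finset.sum_eq_sum_iff_of_le hterm).1 hsum
  refine eq_of_eq_compl H U hU _ _ hHx fun j hj => ?_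
  have := heq j (Finset.mem_compl.2 hj)
  exact (mul_left_cancel₀ (sub_ne_zero.2 (htie j hj).symm) this).symm

/-- The open cell. -/
def ocell (H : Matrix (Fin nr) (Fin nt) ℝ) (U : Finset (Fin nt)) : Set (Fin nr → ℝ) :=
  (fun t => H.mulVec (lamU H U t)) '' obox nr

lemma ocell_disjoint (H : Matrix (Fin nr) (Fin nt) ℝ)
    (htie : ∀ U ∈ goodSets H, ∀ j ∉ U, aUj H U j ≠ 1) (U U' : Finset (Fin nt)) (hU : U ∈ goodSets H)
    (hU' : U' ∈ goodSets H) (hne : U ≠ U') : Disjoint (ocell H U) (ocell H U') := by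
  rw [Set.disjoint_left]
  rintro y ⟨t, ht, rfl⟩ ⟨t', ht', hy⟩
  have hy : H.mulVec (lamU H U' t') = H.mulVec (lamU H U t) := hy
  apply hne
  have heq : lamU H U t = lamU H U' t' := by
    rcases le_total (∑ k, lamU H U t k) (∑ k, lamU H U' t' k) with h | h
    · exact lamU_unique H U' hU' (htie U' hU') t' _ (lamU_mem_Icc H U hU.1 t ht) hy.symm h
    · exact (lamU_unique H U hU (htie U hU) t _ (lamU_mem_Icc H U' hU'.1 t' ht') hy h).symm
  ext k
  rw [lamU_frac H U hU.1 t ht, lamU_frac H U' hU'.1 t' ht', heq]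

lemma exists_perturb (x d : Fin nt → ℝ) (hx : ∀ k, x k ∈ Set.Icc (0 : ℝ) 1)
    (hp : ∀ k, 0 < d k → x k < 1) (hm : ∀ k, d k < 0 → 0 < x k) :
    ∃ ε : ℝ, 0 < ε ∧ ∀ k, x k + ε * d k ∈ Set.Icc (0 : ℝ) 1 := by
  have h : ∀ᶠ ε in 𝓝[>] (0 : ℝ), ∀ k, x k + ε * d k ∈ Set.Icc (0 : ℝ) 1 := by
    rw [eventually_all]
    intro k
    have hc : Tendsto (fun ε : ℝ => x k + ε * d k) (𝓝[>] 0) (𝓝 (x k)) := by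
      have : Continuous (fun ε : ℝ => x k + ε * d k) := by fun_prop
      have := this.tendsto 0
      simp only [zero_mul, add_zero] at this
      exact this.mono_left nhdsWithin_le_nhds
    have hpos : ∀ᶠ ε in 𝓝[>] (0 : ℝ), 0 < ε := self_mem_nhdsWithin
    rcases lt_trichotomy (d k) 0 with hd | hd | hd
    · filter_upwards [hpos, hc.eventually (lt_mem_nhds (hm k hd))] with ε he h1
      exact ⟨h1.le, by nlinarith [(hx k).2, mul_neg_of_pos_of_neg he hd]⟩
    · filter_upwards with ε
      simpa [hd] using hx k
    · filter_upwards [hpos, hc.eventually (gt_mem_nhds (hp k hd))] with ε he h1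
      exact ⟨by nlinarith [(hx k).1, mul_pos he hd], h1.le⟩
  obtain ⟨ε, h1, h2⟩ := (h.and self_mem_nhdsWithin).exists
  exact ⟨ε, h2, h1⟩

/-- A minimizer whose fractional set contains a basis `U` comes from the open cell of `U`. -/
lemma minimizer_eq (H : Matrix (Fin nr) (Fin nt) ℝ) (U : Finset (Fin nt)) (hU : U ∈ goodSets H)
    (htie : ∀ j ∉ U, aUj H U j ≠ 1) (x : Fin nt → ℝ) (hx : ∀ k, x k ∈ Set.Icc (0 : ℝ) 1)
    (hfrac : ∀ k ∈ U, x k ∈ Set.Ioo (0 : ℝ) 1)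
    (hmin : ∀ x' : Fin nt → ℝ, (∀ k, x' k ∈ Set.Icc (0 : ℝ) 1) → H.mulVec x' = H.mulVec x →
      ∑ k, x k ≤ ∑ k, x' k) :
    H.mulVec x ∈ ocell H U := by
  -- general descent principle
  have hdesc : ∀ d : Fin nt → ℝ, H.mulVec d = 0 → (∀ k, 0 < d k → x k < 1) → (∀ k, d k < 0 → 0 < x k) →
      0 ≤ ∑ k, d k := by
    intro d hd hp hm
    obtain ⟨ε, he, hb⟩ := exists_perturb x d hx hp hm
    have h1 := hmin (x + ε • d) hb (by rw [Matrix.mulVec_add, Matrix.mulVec_smul, hd]; simp)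
    simp only [Pi.add_apply, Pi.smul_apply, smul_eq_mul, Finset.sum_add_distrib, ← Finset.mul_sum] at h1
    exact nonneg_of_mul_nonneg_right (by linarith) he
  have hval : ∀ j ∉ U, x j = gUj H U j := by
    intro j hj
    set d : Fin nt → ℝ := extU U (-((HU H U)⁻¹.mulVec (fun r => H r j))) (Pi.single j 1) with hd
    have hdet : IsUnit (HU H U).det := (det_ne_zero H U hU).isUnit
    have hdj : ∀ k ∉ U, d k = (Pi.single j (1 : ℝ) : Fin nt → ℝ) k := fun k hk => by
      rw [hd, extU_notMem _ _ _ _ hk]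
    have hdU : (fun i => d (U.orderEmbOfFin hU.1 i)) = -((HU H U)⁻¹.mulVec (fun r => H r j)) := by
      ext i; rw [hd, extU_mem]
    have hHd : H.mulVec d = 0 := by
      rw [mulVec_split H U hU.1, hdU, Matrix.mulVec_neg, Matrix.mulVec_mulVec, Matrix.mul_nonsing_inv _ hdet,
        Matrix.one_mulVec, Finset.sum_eq_single j]
      · rw [hdj j hj]; simp
      · intro k hk hkj
        rw [hdj k (Finset.mem_compl.1 hk)]; simp [hkj]
      · intro hk; exact absurd (Finset.mem_compl.2 hj) hk
    have hsum : ∑ k, d k = 1 - aUj H U j := by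
      rw [sum_eq H U hU, hHd, Finset.sum_eq_single j]
      · rw [hdj j hj]; simp
      · intro k hk hkj
        rw [hdj k (Finset.mem_compl.1 hk)]; simp [hkj]
      · intro hk; exact absurd (Finset.mem_compl.2 hj) hk
    have hcase : ∀ k, k ∈ U ∨ k = j ∨ d k = 0 := by
      intro k
      by_cases hk : k ∈ U
      · exact Or.inl hk
      · by_cases hkj : k = j
        · exact Or.inr (Or.inl hkj)
        · right; right; rw [hdj k hk]; simp [hkj]
    have hdj1 : d j = 1 := by rw [hdj j hj]; simp
    have hup : x j < 1 → aUj H U j ≤ 1 := by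
      intro hlt
      have := hdesc d hHd (fun k hk => by
        rcases hcase k with h | h | h
        · exact (hfrac k h).2
        · rw [h]; exact hlt
        · linarith) (fun k hk => by
        rcases hcase k with h | h | h
        · exact (hfrac k h).1
        · rw [h, hdj1] at hk; linarith
        · linarith)
      linarith
    have hdown : 0 < x j → 1 ≤ aUj H U j := by
      intro hlt
      have := hdesc (-d) (by rw [Matrix.mulVec_neg, hHd, neg_zero]) (fun k hk => by
        rw [Pi.neg_apply] at hk
        rcases hcase k with h | h | h
        · exact (hfrac k h).2
        · rw [h, hdj1] at hk; linarith
        · linarith) (fun k hk => by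
        rw [Pi.neg_apply] at hk
        rcases hcase k with h | h | h
        · exact (hfrac k h).1
        · rw [h]; exact hlt
        · linarith)
      simp only [Pi.neg_apply, Finset.sum_neg_distrib] at this
      linarith
    unfold gUj
    split_ifs with ha
    · by_contra hne
      exact absurd (hup (lt_of_le_of_ne (hx j).2 hne)) (not_le.2 ha)
    · by_contra hne
      have := hdown (lt_of_le_of_ne (hx j).1 (Ne.symm hne))
      exact htie j hj (le_antisymm (not_lt.1 ha) this)
  refine ⟨fun i => x (U.orderEmbOfFin hU.1 i), fun i _ => hfrac _ (Finset.orderEmbOfFin_mem U hU.1 i), ?_⟩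
  have : lamU H U (fun i => x (U.orderEmbOfFin hU.1 i)) = x := by
    ext k
    by_cases hk : k ∈ U
    · obtain ⟨i, rfl⟩ := exists_emb U hU.1 k hk
      rw [lamU, extU_mem]
    · rw [lamU, extU_notMem _ _ _ _ hk, hval k hk]
  simp only [this]

end MimoOptical

namespace MimoOptical
variable {nt nr : ℕ}

lemma exists_good_subset (H : Matrix (Fin nr) (Fin nt) ℝ) (F : Finset (Fin nt))
    (hF : Submodule.span ℝ ((fun j r => H r j) '' (F : Set (Fin nt))) = ⊤) :
    ∃ U ⊆ F, U ∈ goodSets H := by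
  classical
  obtain ⟨b, hb1, -, hb2, hb3⟩ := exists_linearIndepOn_extension (K := ℝ) (v := fun (j : Fin nt) r => H r j)
    (s := ∅) (t := (F : Set (Fin nt))) (linearIndepOn_empty _ _) (Set.empty_subset _)
  have hspan : Submodule.span ℝ ((fun j r => H r j) '' b) = ⊤ := by
    rw [eq_top_iff, ← hF]
    exact Submodule.span_le.2 hb2
  refine ⟨b.toFinset, fun k hk => by simpa using hb1 (by simpa using hk), ?_, ?_⟩
  · have h1 := finrank_span_eq_card hb3
    have h2 : Set.range (fun x : b => (fun r => H r x.1)) = (fun j r => H r j) '' b := by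
      ext y; simp
    have h2' : Set.range (fun x : b => (fun (j : Fin nt) r => H r j) x.1) = (fun j r => H r j) '' b := h2
    rw [h2', hspan, finrank_top, Module.finrank_fin_fun] at h1
    rw [Set.toFinset_card]
    exact h1.symm
  · exact hb3.comp (fun j : {x // x ∈ b.toFinset} => (⟨j.1, Set.mem_toFinset.1 j.2⟩ : b))
      (fun i j hij => Subtype.ext (congrArg (fun z : b => z.1) hij))

/-- The exceptional null set. -/
def badSet (H : Matrix (Fin nr) (Fin nt) ℝ) : Set (Fin nr → ℝ) :=
  ⋃ F : Finset (Fin nt), ⋃ G : Finset (Fin nt),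
    {y | Submodule.span ℝ ((fun j r => H r j) '' (F : Set (Fin nt))) ≠ ⊤ ∧
      -(∑ j ∈ G, fun r => H r j) + y ∈ Submodule.span ℝ ((fun j r => H r j) '' (F : Set (Fin nt)))}

lemma badSet_null (H : Matrix (Fin nr) (Fin nt) ℝ) : volume (badSet H) = 0 := by
  unfold badSet
  rw [measure_iUnion_null_iff]
  intro F
  rw [measure_iUnion_null_iff]
  intro G
  by_cases h : Submodule.span ℝ ((fun j r => H r j) '' (F : Set (Fin nt))) = ⊤
  · simp [h]
  · have := Measure.addHaar_submodule (volume : Measure (Fin nr → ℝ)) _ h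
    rw [← measure_preimage_add volume (-(∑ j ∈ G, fun r => H r j))] at this
    refine measure_mono_null ?_ this
    intro y hy
    exact hy.2

lemma zonotope_subset (H : Matrix (Fin nr) (Fin nt) ℝ)
    (htie : ∀ U ∈ goodSets H, ∀ j ∉ U, aUj H U j ≠ 1) :
    zonotope H 1 ⊆ badSet H ∪ ⋃ U ∈ goodSets H, ocell H U := by
  classical
  rintro y ⟨x0, hx0, rfl⟩
  by_cases hbad : H.mulVec x0 ∈ badSet H
  · exact Or.inl hbad
  right
  have hc : IsCompact ((Set.univ.pi fun _ : Fin nt => Set.Icc (0 : ℝ) 1) ∩ {x | H.mulVec x = H.mulVec x0}) := by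
    refine (isCompact_univ_pi fun _ => isCompact_Icc).inter_right ?_
    exact isClosed_eq (by fun_prop) continuous_const
  obtain ⟨x, ⟨hx, hHx⟩, hmin⟩ := hc.exists_isMinOn ⟨x0, fun k _ => hx0 k, rfl⟩
    (f := fun x : Fin nt → ℝ => ∑ k, x k) (Continuous.continuousOn (by fun_prop))
  have hHx : H.mulVec x = H.mulVec x0 := hHx
  have hx : ∀ k, x k ∈ Set.Icc (0 : ℝ) 1 := fun k => hx k trivial
  set F : Finset (Fin nt) := Finset.univ.filter fun k => x k ∈ Set.Ioo (0 : ℝ) 1 with hF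
  set G : Finset (Fin nt) := Finset.univ.filter fun k => x k = 1 with hG
  have hspan : Submodule.span ℝ ((fun j r => H r j) '' (F : Set (Fin nt))) = ⊤ := by
    by_contra hne
    apply hbad
    rw [badSet]
    simp only [Set.mem_iUnion]
    refine ⟨F, G, hne, ?_⟩
    have : H.mulVec x0 = ∑ j ∈ G, (fun r => H r j) + ∑ j ∈ F, x j • (fun r => H r j) := by
      rw [← hHx]
      have h1 : H.mulVec x = ∑ j, x j • (fun r => H r j) := by
        ext r; simp [Matrix.mulVec, dotProduct, mul_comm]
      rw [h1, hF, hG, Finset.sum_filter, Finset.sum_filter, ← Finset.sum_add_distrib]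
      refine Finset.sum_congr rfl fun k _ => ?_
      by_cases hk1 : x k = 1
      · simp [hk1]
      · by_cases hk0 : x k = 0
        · simp [hk0]
        · have : x k ∈ Set.Ioo (0 : ℝ) 1 :=
            ⟨lt_of_le_of_ne (hx k).1 (Ne.symm hk0), lt_of_le_of_ne (hx k).2 hk1⟩
          rw [if_neg hk1, if_pos this, zero_add]
    rw [this, neg_add_cancel_left]
    exact Submodule.sum_mem _ fun j hj => Submodule.smul_mem _ _ (Submodule.subset_span ⟨j, hj, rfl⟩)
  obtain ⟨U, hUF, hU⟩ := exists_good_subset H F hspan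
  simp only [Set.mem_iUnion]
  refine ⟨U, hU, ?_⟩
  rw [← hHx]
  refine minimizer_eq H U hU (htie U hU) x hx (fun k hk => ?_) ?_
  · have := hUF hk
    rw [hF, Finset.mem_filter] at this
    exact this.2
  · intro x' hx' hH'
    exact hmin ⟨fun k _ => hx' k, hH'.trans hHx⟩

lemma mulVec_lamU (H : Matrix (Fin nr) (Fin nt) ℝ) (U : Finset (Fin nt)) (h : U.card = nr) (t : Fin nr → ℝ) :
    H.mulVec (lamU H U t) = (∑ j ∈ Uᶜ, gUj H U j • (fun r => H r j)) + (HU H U).mulVec t := by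
  rw [mulVec_split H U h, add_comm]
  congr 1
  · refine Finset.sum_congr rfl fun j hj => ?_
    rw [lamU, extU_notMem _ _ _ _ (Finset.mem_compl.1 hj)]
  · congr 1
    ext i
    rw [lamU, extU_mem]

lemma measurableSet_obox (n : ℕ) : MeasurableSet (obox n) := MeasurableSet.univ_pi fun _ => measurableSet_Ioo

lemma volume_obox (n : ℕ) : volume (obox n) = 1 := by
  unfold obox
  rw [volume_pi_pi]
  simp

lemma volume_image_lamU (H : Matrix (Fin nr) (Fin nt) ℝ) (U : Finset (Fin nt)) (h : U.card = nr)
    (s : Set (Fin nr → ℝ)) :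
    volume ((fun t => H.mulVec (lamU H U t)) '' s) = ENNReal.ofReal |(HU H U).det| * volume s := by
  have h1 : (fun t => H.mulVec (lamU H U t)) '' s
      = (fun y => (∑ j ∈ Uᶜ, gUj H U j • (fun r => H r j)) + y) '' ((Matrix.toLin' (HU H U)) '' s) := by
    rw [Set.image_image]
    simp only [mulVec_lamU H U h, Matrix.toLin'_apply]
  rw [h1, Set.image_add_left, measure_preimage_add, Measure.addHaar_image_linearMap, LinearMap.det_toLin']

lemma measurable_lamU (H : Matrix (Fin nr) (Fin nt) ℝ) (U : Finset (Fin nt)) (h : U.card = nr) :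
    Measurable (lamU H U) := by
  rw [measurable_pi_iff]
  intro k
  by_cases hk : k ∈ U
  · obtain ⟨i, rfl⟩ := exists_emb U h k hk
    simp only [lamU, extU_mem]
    exact measurable_pi_apply i
  · simp only [lamU, extU_notMem _ _ _ _ hk]
    exact measurable_const

open Classical in
/-- The good sets as a finset. -/
def goodF (H : Matrix (Fin nr) (Fin nt) ℝ) : Finset (Finset (Fin nt)) :=
  Finset.univ.filter fun U => U ∈ goodSets H

lemma mem_goodF (H : Matrix (Fin nr) (Fin nt) ℝ) (U : Finset (Fin nt)) : U ∈ goodF H ↔ U ∈ goodSets H := by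
  simp [goodF]

lemma finsum_good (H : Matrix (Fin nr) (Fin nt) ℝ) (f : Finset (Fin nt) → ℝ) :
    ∑ᶠ U ∈ goodSets H, f U = ∑ U ∈ goodF H, f U := by
  refine finsum_mem_eq_sum_of_inter_support_eq _ ?_
  ext U; simp [mem_goodF]

lemma VH_eq (H : Matrix (Fin nr) (Fin nt) ℝ) : VH H = ∑ U ∈ goodF H, |(HU H U).det| := finsum_good H _

lemma VH_pos (H : Matrix (Fin nr) (Fin nt) ℝ) (hrank : H.rank = nr) : 0 < VH H := by
  have hspan : Submodule.span ℝ ((fun j r => H r j) '' ((Finset.univ : Finset (Fin nt)) : Set (Fin nt))) = ⊤ := by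
    rw [Matrix.rank_eq_finrank_span_cols] at hrank
    have h1 : (fun j r => H r j) '' ((Finset.univ : Finset (Fin nt)) : Set (Fin nt)) = Set.range H.col := by
      rw [Finset.coe_univ, Set.image_univ]; rfl
    rw [h1]
    exact Submodule.eq_top_of_finrank_eq (by rw [hrank]; simp)
  obtain ⟨U, -, hU⟩ := exists_good_subset H _ hspan
  rw [VH_eq]
  exact Finset.sum_pos (fun U hU => abs_pos.2 (det_ne_zero H U ((mem_goodF H U).1 hU))) ⟨U, (mem_goodF H U).2 hU⟩

lemma volume_zonotope_le (H : Matrix (Fin nr) (Fin nt) ℝ)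
    (htie : ∀ U ∈ goodSets H, ∀ j ∉ U, aUj H U j ≠ 1) :
    volume (zonotope H 1) ≤ ENNReal.ofReal (VH H) := by
  calc volume (zonotope H 1) ≤ volume (badSet H ∪ ⋃ U ∈ goodF H, ocell H U) := by
        refine measure_mono ((zonotope_subset H htie).trans ?_)
        simp only [mem_goodF]; exact le_rfl
    _ ≤ volume (badSet H) + volume (⋃ U ∈ goodF H, ocell H U) := measure_union_le _ _
    _ ≤ 0 + ∑ U ∈ goodF H, volume (ocell H U) := by
        rw [badSet_null]
        gcongr
        exact measure_biUnion_finset_le _ _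
    _ = ∑ U ∈ goodF H, ENNReal.ofReal |(HU H U).det| := by
        rw [zero_add]
        refine Finset.sum_congr rfl fun U hU => ?_
        rw [ocell, volume_image_lamU H U ((mem_goodF H U).1 hU).1, volume_obox, mul_one]
    _ = ENNReal.ofReal (VH H) := by
        rw [VH_eq, ENNReal.ofReal_sum_of_nonneg fun _ _ => abs_nonneg _]

lemma isCompact_zonotope (H : Matrix (Fin nr) (Fin nt) ℝ) (A : ℝ) : IsCompact (zonotope H A) := by
  have : zonotope H A = (fun x => H.mulVec x) '' (Set.univ.pi fun _ : Fin nt => Set.Icc (0 : ℝ) A) := by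
    ext y
    constructor
    · rintro ⟨x, hx, rfl⟩; exact ⟨x, fun k _ => hx k, rfl⟩
    · rintro ⟨x, hx, rfl⟩; exact ⟨x, fun k => hx k trivial, rfl⟩
  rw [this]
  exact (isCompact_univ_pi fun _ => isCompact_Icc).image (by fun_prop)

end MimoOptical

namespace MimoOptical
variable {nt nr : ℕ}

lemma injective_cellMap (H : Matrix (Fin nr) (Fin nt) ℝ) (U : Finset (Fin nt)) (hU : U ∈ goodSets H) :
    Function.Injective (fun t => H.mulVec (lamU H U t)) := by
  intro t t' h
  simp only [mulVec_lamU H U hU.1] at h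
  have h1 := add_left_cancel h
  have hd : IsUnit (HU H U) := (Matrix.isUnit_iff_isUnit_det _).2 (det_ne_zero H U hU).isUnit
  exact Matrix.mulVec_injective_of_isUnit hd h1

lemma continuous_cellMap (H : Matrix (Fin nr) (Fin nt) ℝ) (U : Finset (Fin nt)) (hU : U ∈ goodSets H) :
    Continuous (fun t => H.mulVec (lamU H U t)) := by
  simp only [mulVec_lamU H U hU.1]
  fun_prop

lemma measurableSet_ocell (H : Matrix (Fin nr) (Fin nt) ℝ) (U : Finset (Fin nt)) (hU : U ∈ goodSets H) :
    MeasurableSet (ocell H U) :=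
  (measurableSet_obox nr).image_of_continuousOn_injOn (continuous_cellMap H U hU).continuousOn
    (injective_cellMap H U hU).injOn

/-- The capacity-approaching input on the unit cube. -/
def mu1 (H : Matrix (Fin nr) (Fin nt) ℝ) : Measure (Fin nt → ℝ) :=
  ∑ U ∈ goodF H, ENNReal.ofReal (qU H U) • ((volume.restrict (obox nr)).map (lamU H U))

instance (n : ℕ) : IsProbabilityMeasure ((volume : Measure (Fin n → ℝ)).restrict (obox n)) :=
  ⟨by rw [Measure.restrict_apply_univ, volume_obox]⟩

lemma qU_nonneg (H : Matrix (Fin nr) (Fin nt) ℝ) (hV : 0 < VH H) (U : Finset (Fin nt)) : 0 ≤ qU H U :=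
  div_nonneg (abs_nonneg _) hV.le

lemma sum_qU (H : Matrix (Fin nr) (Fin nt) ℝ) (hV : 0 < VH H) : ∑ U ∈ goodF H, qU H U = 1 := by
  simp only [qU]
  rw [← Finset.sum_div, ← VH_eq, div_self hV.ne']

lemma isProb_mu1 (H : Matrix (Fin nr) (Fin nt) ℝ) (hV : 0 < VH H) : IsProbabilityMeasure (mu1 H) := by
  constructor
  rw [mu1, Measure.finsetSum_apply]
  have : ∀ U ∈ goodF H, (ENNReal.ofReal (qU H U) • ((volume.restrict (obox nr)).map (lamU H U))) Set.univ
      = ENNReal.ofReal (qU H U) := by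
    intro U hU
    rw [Measure.smul_apply, Measure.map_apply (measurable_lamU H U ((mem_goodF H U).1 hU).1) MeasurableSet.univ,
      Set.preimage_univ, measure_univ, smul_eq_mul, mul_one]
  rw [Finset.sum_congr rfl this, ← ENNReal.ofReal_sum_of_nonneg fun U _ => qU_nonneg H hV U, sum_qU H hV,
    ENNReal.ofReal_one]

lemma measurableSet_cube (A : ℝ) : MeasurableSet {x : Fin nt → ℝ | ∀ k, x k ∈ Set.Icc (0 : ℝ) A} := by
  have : {x : Fin nt → ℝ | ∀ k, x k ∈ Set.Icc (0 : ℝ) A} = Set.univ.pi fun _ => Set.Icc (0 : ℝ) A := by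
    ext x; exact ⟨fun hx k _ => hx k, fun hx k => hx k trivial⟩
  rw [this]
  exact MeasurableSet.univ_pi fun _ => measurableSet_Icc

lemma ae_mu1 (H : Matrix (Fin nr) (Fin nt) ℝ) : ∀ᵐ x ∂(mu1 H), ∀ k, x k ∈ Set.Icc (0 : ℝ) 1 := by
  rw [mu1, ae_finsetSum_measure_iff]
  intro U hU
  have hc := ((mem_goodF H U).1 hU).1
  refine Measure.ae_smul_measure ?_ _
  rw [ae_map_iff (measurable_lamU H U hc).aemeasurable (measurableSet_cube 1)]
  filter_upwards [ae_restrict_mem (measurableSet_obox nr)] with t ht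
  exact lamU_mem_Icc H U hc t ht

lemma integral_obox (n : ℕ) (i : Fin n) : ∫ t in obox n, t i = 1 / 2 := by
  have h0 : IsProbabilityMeasure ((volume : Measure ℝ).restrict (Set.Ioo 0 1)) :=
    ⟨by simp⟩
  have h1 : (volume : Measure (Fin n → ℝ)).restrict (obox n)
      = Measure.pi fun _ => (volume : Measure ℝ).restrict (Set.Ioo 0 1) := by
    rw [obox, volume_pi, Measure.restrict_pi_pi]
  have hmp := measurePreserving_eval (fun _ : Fin n => (volume : Measure ℝ).restrict (Set.Ioo 0 1)) i
  rw [h1]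
  have h2 := integral_map (μ := Measure.pi fun _ : Fin n => (volume : Measure ℝ).restrict (Set.Ioo 0 1))
    (φ := Function.eval i) hmp.measurable.aemeasurable (f := fun x : ℝ => x) (by fun_prop)
  rw [hmp.map_eq] at h2
  refine h2.symm.trans ?_
  rw [← integral_Ioc_eq_integral_Ioo, ← intervalIntegral.integral_of_le zero_le_one, integral_id]
  norm_num

lemma integrable_obox (n : ℕ) (i : Fin n) : Integrable (fun t : Fin n → ℝ => t i) (volume.restrict (obox n)) := by
  refine Integrable.mono' (integrable_const 1) (measurable_pi_apply i).aestronglyMeasurable ?_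
  filter_upwards [ae_restrict_mem (measurableSet_obox n)] with t ht
  have := ht i trivial
  rw [Real.norm_eq_abs, abs_of_pos this.1]
  exact this.2.le

lemma integral_mu1 (H : Matrix (Fin nr) (Fin nt) ℝ) (hV : 0 < VH H) :
    ∫ x, ∑ k, |x k| ∂(mu1 H) = alphaTh H := by
  have hprob := isProb_mu1 H hV
  have hm : Measurable fun x : Fin nt → ℝ => ∑ k, |x k| := by fun_prop
  have hcell : ∀ U ∈ goodF H, ∫ x, ∑ k, |x k| ∂((volume.restrict (obox nr)).map (lamU H U))
      = nr / 2 + sU H U := by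
    intro U hU
    have hc := ((mem_goodF H U).1 hU).1
    rw [integral_map (measurable_lamU H U hc).aemeasurable hm.aestronglyMeasurable]
    have : ∫ t in obox nr, ∑ k, |lamU H U t k| = ∫ t in obox nr, (∑ i, t i + sU H U) := by
      refine integral_congr_ae ?_
      filter_upwards [ae_restrict_mem (measurableSet_obox nr)] with t ht
      have h1 : ∑ k, |lamU H U t k| = ∑ k, lamU H U t k :=
        Finset.sum_congr rfl fun k _ => abs_of_nonneg (lamU_mem_Icc H U hc t ht k).1
      rw [h1, sum_split U hc]
      congr 1
      · refine Finset.sum_congr rfl fun i _ => ?_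
        rw [lamU, extU_mem]
      · rw [sU]
        refine Finset.sum_congr rfl fun j hj => ?_
        rw [lamU, extU_notMem _ _ _ _ (Finset.mem_compl.1 hj)]
    rw [this, integral_add (integrable_finsetSum _ fun i _ => integrable_obox nr i) (integrable_const _),
      integral_finsetSum _ fun i _ => integrable_obox nr i]
    simp [integral_obox]
    ring
  rw [mu1, integral_finsetSum_measure]
  · have : ∀ U ∈ goodF H, ∫ x, ∑ k, |x k| ∂(ENNReal.ofReal (qU H U) • ((volume.restrict (obox nr)).map (lamU H U)))
        = (nr / 2) * qU H U + sU H U * qU H U := by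
      intro U hU
      rw [integral_smul_measure, hcell U hU, ENNReal.toReal_ofReal (qU_nonneg H hV U), smul_eq_mul]
      ring
    rw [Finset.sum_congr rfl this, Finset.sum_add_distrib, ← Finset.mul_sum, sum_qU H hV, alphaTh, finsum_good,
      mul_one]
  · intro U hU
    have hc := ((mem_goodF H U).1 hU).1
    refine Integrable.smul_measure ?_ ENNReal.ofReal_ne_top
    have : IsProbabilityMeasure ((volume.restrict (obox nr)).map (lamU H U)) :=
      Measure.isProbabilityMeasure_map (measurable_lamU H U hc).aemeasurable
    refine Integrable.mono' (integrable_const (nt : ℝ)) hm.aestronglyMeasurable ?_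
    rw [ae_map_iff (measurable_lamU H U hc).aemeasurable (measurableSet_le hm.norm measurable_const)]
    filter_upwards [ae_restrict_mem (measurableSet_obox nr)] with t ht
    rw [Real.norm_of_nonneg (by positivity)]
    calc ∑ k, |lamU H U t k| ≤ ∑ k : Fin nt, (1 : ℝ) := by
          refine Finset.sum_le_sum fun k _ => ?_
          have := lamU_mem_Icc H U hc t ht k
          rw [abs_of_nonneg this.1]; exact this.2
      _ = nt := by simp

lemma map_mu1_le (H : Matrix (Fin nr) (Fin nt) ℝ) (hV : 0 < VH H)
    (htie : ∀ U ∈ goodSets H, ∀ j ∉ U, aUj H U j ≠ 1) :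
    (mu1 H).map (fun x => H.mulVec x) ≤ ENNReal.ofReal ((VH H)⁻¹) • volume := by
  refine Measure.le_iff.2 fun s hs => ?_
  rw [Measure.map_apply (measurable_mulVec H) hs, mu1, Measure.finsetSum_apply]
  have : ∀ U ∈ goodF H, (ENNReal.ofReal (qU H U) • ((volume.restrict (obox nr)).map (lamU H U)))
      ((fun x => H.mulVec x) ⁻¹' s) = ENNReal.ofReal ((VH H)⁻¹) * volume (ocell H U ∩ s) := by
    intro U hU
    have hg := (mem_goodF H U).1 hU
    have hml := measurable_lamU H U hg.1
    have hms := measurable_mulVec H hs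
    rw [Measure.smul_apply, Measure.map_apply hml hms, Measure.restrict_apply (hml hms), smul_eq_mul, qU,
      div_eq_inv_mul, ENNReal.ofReal_mul (inv_nonneg.2 hV.le), mul_assoc, ← volume_image_lamU H U hg.1]
    congr 2
    rw [ocell, ← Set.image_inter_preimage, Set.inter_comm]
    rfl
  rw [Finset.sum_congr rfl this, ← Finset.mul_sum, Measure.smul_apply, smul_eq_mul]
  gcongr
  rw [← measure_biUnion_finset]
  · refine measure_mono ?_
    simp
  · intro U hU U' hU' hne
    exact (ocell_disjoint H htie U U' ((mem_goodF H U).1 hU) ((mem_goodF H U').1 hU') hne).mono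
      Set.inter_subset_left Set.inter_subset_left
  · intro U hU
    exact (measurableSet_ocell H U ((mem_goodF H U).1 hU)).inter hs

/-- The scaled input. -/
def muA (H : Matrix (Fin nr) (Fin nt) ℝ) (A : ℝ) : Measure (Fin nt → ℝ) := (mu1 H).map (fun x => A • x)

lemma admissible_muA (H : Matrix (Fin nr) (Fin nt) ℝ) (hV : 0 < VH H) (A : ℝ) (hA : 0 < A) (α : ℝ)
    (h : alphaTh H ≤ α) : Admissible nt A (α * A) (muA H A) := by
  have hprob := isProb_mu1 H hV
  have hm : Measurable fun x : Fin nt → ℝ => A • x := measurable_const_smul A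
  refine ⟨Measure.isProbabilityMeasure_map hm.aemeasurable, ?_, ?_⟩
  · rw [muA, ae_map_iff hm.aemeasurable (measurableSet_cube A)]
    filter_upwards [ae_mu1 H] with x hx k
    have := hx k
    simp only [Pi.smul_apply, smul_eq_mul, Set.mem_Icc]
    exact ⟨mul_nonneg hA.le this.1, by nlinarith [this.2]⟩
  · rw [muA, integral_map hm.aemeasurable (Measurable.aestronglyMeasurable (by fun_prop))]
    simp only [Pi.smul_apply, smul_eq_mul, abs_mul, abs_of_pos hA, ← Finset.mul_sum]
    rw [integral_const_mul, integral_mu1 H hV]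
    nlinarith

lemma map_muA_le (H : Matrix (Fin nr) (Fin nt) ℝ) (hV : 0 < VH H)
    (htie : ∀ U ∈ goodSets H, ∀ j ∉ U, aUj H U j ≠ 1) (A : ℝ) (hA : 0 < A) :
    (muA H A).map (fun x => H.mulVec x) ≤ ENNReal.ofReal ((A ^ nr * VH H)⁻¹) • volume := by
  have hm : Measurable fun x : Fin nt → ℝ => A • x := measurable_const_smul A
  have hm' : Measurable fun x : Fin nr → ℝ => A • x := measurable_const_smul A
  have h1 : (muA H A).map (fun x => H.mulVec x) = ((mu1 H).map (fun x => H.mulVec x)).map (fun y => A • y) := by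
    rw [muA, Measure.map_map (measurable_mulVec H) hm, Measure.map_map hm' (measurable_mulVec H)]
    congr 1
    ext x : 1
    simp [Matrix.mulVec_smul]
  rw [h1]
  refine (Measure.map_mono (map_mu1_le H hV htie) hm').trans (le_of_eq ?_)
  rw [Measure.map_smul, Measure.map_addHaar_smul volume hA.ne', smul_smul, Module.finrank_fin_fun,
    abs_of_pos (by positivity), ← ENNReal.ofReal_mul (by positivity), mul_inv, mul_comm]

lemma integral_wS_pos {n : ℕ} (hn : 1 ≤ n) (S : Set (Fin n → ℝ)) (hS : IsCompact S) (hne : S.Nonempty)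
    (l : ℝ) (hl : 1 ≤ l) : 0 < ∫ y, wS S l y := by
  rw [integral_pos_iff_support_of_nonneg (fun y => (wS_pos S l y).le) (integrable_wS hn S hS hne l hl)]
  have : Function.support (wS S l) = Set.univ := by
    ext y; simpa using (wS_pos S l y).ne'
  rw [this]; exact isOpen_univ.measure_pos volume Set.univ_nonempty

end MimoOptical

/-- High-SNR asymptotics for `α ≥ α_th`:
`lim_{A→∞} [C_H(A, αA) − nr log A] = (1/2) log(V_H² / (2πe)^{nr})`. -/
theorem MimoOptical.high_snr_asymptotics_of_alphaTh_le
    (nt nr : ℕ) (hnr : 1 ≤ nr) (hntnr : nr < nt)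
    (H : Matrix (Fin nr) (Fin nt) ℝ) (hrank : H.rank = nr)
    (α : ℝ) (hα : 0 < α)
    (htie : ∀ U ∈ MimoOptical.goodSets H, ∀ j ∉ U, MimoOptical.aUj H U j ≠ 1)
    (h : MimoOptical.alphaTh H ≤ α) :
    Filter.Tendsto (fun A : ℝ => MimoOptical.capacity H A (α * A) - (nr : ℝ) * Real.log A)
      Filter.atTop
      (nhds ((1 / 2) * Real.log ((MimoOptical.VH H) ^ 2
        / (2 * Real.pi * Real.exp 1) ^ nr))) := by

  classical
  have hV := MimoOptical.VH_pos H hrank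
  set S := MimoOptical.zonotope H 1 with hS
  have hSc : IsCompact S := MimoOptical.isCompact_zonotope H 1
  have hSne : S.Nonempty := ⟨H.mulVec 0, 0, fun i => by simp, rfl⟩
  set c : ℝ := -(nr / 2) * Real.log (2 * Real.pi) - nr / 2 with hc
  have hL : (1 / 2) * Real.log ((MimoOptical.VH H) ^ 2 / (2 * Real.pi * Real.exp 1) ^ nr)
      = c + Real.log (MimoOptical.VH H) := by
    rw [Real.log_div (by positivity) (by positivity), Real.log_pow, Real.log_pow,
      Real.log_mul (by positivity) (by positivity), Real.log_exp, hc]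
    push_cast
    ring
  rw [hL]
  -- the basic upper bound
  have hub : ∀ m : ℕ, ∀ A : ℝ, 0 < A → ∀ v ∈ { v | ∃ μ : Measure (Fin nt → ℝ),
      MimoOptical.Admissible nt A (α * A) μ ∧ v = MimoOptical.mutualInfoJoint (MimoOptical.jointLaw H μ) },
      v ≤ c + (nr * Real.log A + Real.log (∫ y, MimoOptical.wS S (m + 1) y)) + (m + 1) / A ^ 2 * nr := by
    rintro m A hA v ⟨μ, ⟨hp, hbox, -⟩, rfl⟩
    exact MimoOptical.mutualInfo_le_wS hnr H A hA μ hbox S hSc hSne le_rfl (m + 1)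
      (by have : (0 : ℝ) ≤ m := Nat.cast_nonneg m
          linarith)
  have hne : ∀ A : ℝ, 0 < A → { v | ∃ μ : Measure (Fin nt → ℝ),
      MimoOptical.Admissible nt A (α * A) μ ∧
        v = MimoOptical.mutualInfoJoint (MimoOptical.jointLaw H μ) }.Nonempty := fun A hA =>
    ⟨_, MimoOptical.muA H A, MimoOptical.admissible_muA H hV A hA α h, rfl⟩
  have hlow : ∀ A : ℝ, 0 < A →
      c + Real.log (MimoOptical.VH H) ≤ MimoOptical.capacity H A (α * A) - nr * Real.log A := by
    intro A hA
    have hadm := MimoOptical.admissible_muA H hV A hA α h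
    have := hadm.1
    have h1 := MimoOptical.mutualInfo_ge H A (MimoOptical.muA H A) hadm.2.1 ((A ^ nr * MimoOptical.VH H)⁻¹)
      (by positivity) (MimoOptical.map_muA_le H hV htie A hA)
    rw [Real.log_inv, Real.log_mul (by positivity) hV.ne', Real.log_pow] at h1
    have h2 : MimoOptical.mutualInfoJoint (MimoOptical.jointLaw H (MimoOptical.muA H A))
        ≤ MimoOptical.capacity H A (α * A) :=
      le_csSup ⟨_, hub 0 A hA⟩ ⟨_, hadm, rfl⟩
    linarith
  refine tendsto_order.2 ⟨fun l hl => ?_, fun u hu => ?_⟩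
  · filter_upwards [eventually_gt_atTop (0 : ℝ)] with A hA
    exact lt_of_lt_of_le hl (hlow A hA)
  · have hvol : (volume : Measure (Fin nr → ℝ)).real S ≤ MimoOptical.VH H :=
      ENNReal.toReal_le_of_le_ofReal hV.le (MimoOptical.volume_zonotope_le H htie)
    have hlt : (volume : Measure (Fin nr → ℝ)).real S < Real.exp (u - c) := by
      refine lt_of_le_of_lt hvol ?_
      rw [← Real.log_lt_iff_lt_exp hV]
      linarith
    obtain ⟨m, hm⟩ := ((MimoOptical.tendsto_wS hnr S hSc hSne).eventually_lt_const hlt).exists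
    have hm0 : (0 : ℝ) ≤ m := Nat.cast_nonneg m
    have hKpos := MimoOptical.integral_wS_pos hnr S hSc hSne (m + 1) (by linarith)
    rw [← Real.log_lt_iff_lt_exp hKpos] at hm
    have htend : Tendsto (fun A : ℝ => c + Real.log (∫ y, MimoOptical.wS S (m + 1) y)
        + ((m : ℝ) + 1) / A ^ 2 * nr) atTop
        (nhds (c + Real.log (∫ y, MimoOptical.wS S (m + 1) y) + 0 * nr)) := by
      refine tendsto_const_nhds.add (Tendsto.mul_const _ ?_)
      exact tendsto_const_nhds.div_atTop (tendsto_pow_atTop two_ne_zero)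
    filter_upwards [eventually_gt_atTop (0 : ℝ), htend.eventually_lt_const (by linarith : _ < u)] with A hA h1
    have h2 : MimoOptical.capacity H A (α * A) ≤ _ := csSup_le (hne A hA) (hub m A hA)
    linarith
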